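/- If ρ is a reduced word whose smallest entry is i, then the first (lowest-index) nonempty row of the weak Edelman–Greene insertion tableau P̂(ρ) has index i. -/

import Mathlib

noncomputable section
attribute [local instance] Classical.propDecidable

/-! ### Words, permutations, reduced words -/

/-- The adjacent transposition `s_i` exchanging `i` and `i+1`. -/
def sPerm (i : ℕ) : Equiv.Perm ℕ := Equiv.swap i (i + 1)

/-- The permutation `s_{i_1} ⋯ s_{i_n}` represented by the word `i_1 ⋯ i_n`. -/
def wordPerm (ρ : List ℕ) : Equiv.Perm ℕ := (ρ.map sPerm).prod

/-- A word whose letters are positive integers. -/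
def PosWord (ρ : List ℕ) : Prop := ∀ x ∈ ρ, 1 ≤ x

/-- A reduced word: a word of positive integers of minimal length among all words of
positive integers representing the same permutation. -/
def IsReducedWord (ρ : List ℕ) : Prop :=
  PosWord ρ ∧ ∀ σ : List ℕ, PosWord σ → wordPerm σ = wordPerm ρ → ρ.length ≤ σ.length

/-- `ρ` is a reduced word for the permutation `w`. -/
def IsReducedWordFor (w : Equiv.Perm ℕ) (ρ : List ℕ) : Prop :=
  IsReducedWord ρ ∧ wordPerm ρ = w

/-- A member of `S∞`: a permutation of the positive integers (it fixes `0`)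
fixing all but finitely many points. -/
def FinitaryPerm (w : Equiv.Perm ℕ) : Prop := w 0 = 0 ∧ {i : ℕ | w i ≠ i}.Finite

/-- A flag: a weakly increasing function `φ : ℤ_{>0} → ℤ_{>0}` with `φ(n) ≥ n`. -/
def IsFlag (φ : ℕ → ℕ) : Prop :=
  (∀ m n : ℕ, 1 ≤ m → m ≤ n → φ m ≤ φ n) ∧ ∀ n : ℕ, 1 ≤ n → n ≤ φ n

/-- A weak composition, as a function on the positive integers (value `0` at `0`)
with finitely many nonzero entries. -/
def WeakComp (α : ℕ → ℕ) : Prop := α 0 = 0 ∧ {i : ℕ | α i ≠ 0}.Finite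

/-- `φ - e_i`, i.e. `l ↦ φ(l) - δ_{il}`. -/
def subE (φ : ℕ → ℕ) (i : ℕ) : ℕ → ℕ := fun l => if l = i then φ l - 1 else φ l

/-- The right action of `s_i` on weak compositions, swapping entries `i` and `i+1`. -/
def swapC (α : ℕ → ℕ) (i : ℕ) : ℕ → ℕ := fun j => α (sPerm i j)

/-- `α` has length `k`: `k` is minimal with `α i = 0` for all `i > k`. -/
def HasLen (α : ℕ → ℕ) (k : ℕ) : Prop :=
  (∀ i, k < i → α i = 0) ∧ ∀ m, (∀ i, m < i → α i = 0) → k ≤ m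

/-! ### Coxeter–Knuth equivalence -/

/-- One Coxeter–Knuth move. -/
def CKStep (u v : List ℕ) : Prop :=
  (∃ (a b : List ℕ) (x y z : ℕ), y < x ∧ x < z ∧
      u = a ++ [x, y, z] ++ b ∧ v = a ++ [x, z, y] ++ b) ∨
  (∃ (a b : List ℕ) (x y z : ℕ), y < z ∧ z < x ∧
      u = a ++ [x, y, z] ++ b ∧ v = a ++ [y, x, z] ++ b) ∨
  (∃ (a b : List ℕ) (i : ℕ),
      u = a ++ [i, i + 1, i] ++ b ∧ v = a ++ [i + 1, i, i + 1] ++ b)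

/-- Coxeter–Knuth equivalence: the transitive (symmetric, reflexive) closure of `CKStep`. -/
def CKEquiv : List ℕ → List ℕ → Prop := Relation.EqvGen CKStep

/-! ### Run factorizations and weak descent tableaux -/

/-- The run factorization of a word into maximal strictly increasing blocks
(listed from left to right). -/
def runFact : List ℕ → List (List ℕ)
  | [] => []
  | a :: rest =>
    match runFact rest with
    | [] => [[a]]
    | r :: rs => if a < r.headI then (a :: r) :: rs else [a] :: r :: rs

/-- Auxiliary: rows of the remaining blocks, given the row of the previous block. -/
def wdtRowsAux : ℤ → List (List ℕ) → List ℤ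
  | _, [] => []
  | prev, b :: bs =>
      min (prev - 1) (b.headI : ℤ) :: wdtRowsAux (min (prev - 1) (b.headI : ℤ)) bs

/-- The row indices assigned to the blocks of a run factorization (blocks listed
left to right): the leftmost block goes to the row indexed by its first letter, and each
subsequent block goes to the row indexed by its first letter if this is below the previous
block's row, and otherwise directly below the previous block's row. -/
def wdtRows : List (List ℕ) → List ℤ
  | [] => []
  | b :: bs => (b.headI : ℤ) :: wdtRowsAux (b.headI : ℤ) bs

/-- A tableau: rows indexed by `ℤ` (bottom to top), columns indexed by `ℕ` starting at `1`;
the value `0` means that there is no box, a nonzero value is the (positive) entry. -/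
abbrev Tableau := ℤ → ℕ → ℕ

/-- The weak descent tableau of a word. -/
def weakDesTab (ρ : List ℕ) : Tableau := fun r c =>
  if c = 0 then 0
  else
    match ((wdtRows (runFact ρ)).zip (runFact ρ)).find? (fun p => decide (p.1 = r)) with
    | some p => p.2.getD (c - 1) 0
    | none => 0

/-- A word is non-virtual if its weak descent tableau only occupies rows of positive index. -/
def NonVirtual (ρ : List ℕ) : Prop := ∀ r ∈ wdtRows (runFact ρ), 1 ≤ r

/-- The shape of a tableau: the number of boxes in each (positively indexed) row. -/
def shapeOf (T : Tableau) : ℕ → ℕ := fun i => Set.ncard {c : ℕ | T (i : ℤ) c ≠ 0}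

/-- The weak descent composition of a word: the shape of its weak descent tableau. -/
def desComp (ρ : List ℕ) : ℕ → ℕ := shapeOf (weakDesTab ρ)

/-- Partial-sum (dominance) order on weak compositions. -/
def compLE (μ ν : ℕ → ℕ) : Prop :=
  ∀ k : ℕ, ∑ i ∈ Finset.Icc 1 k, μ i ≤ ∑ i ∈ Finset.Icc 1 k, ν i

/-- A Yamanouchi reduced word: a non-virtual reduced word that is minimal in its
Coxeter–Knuth class among non-virtual words, for the order
`ρ ≤ τ ↔ ρ ~ τ ∧ des ρ ≤ des τ`. -/
def Yamanouchi (ρ : List ℕ) : Prop :=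
  IsReducedWord ρ ∧ NonVirtual ρ ∧
    ∀ σ : List ℕ, NonVirtual σ → CKEquiv ρ σ → compLE (desComp ρ) (desComp σ)

/-- The (unique) Yamanouchi reduced word Coxeter–Knuth equivalent to `ρ`. -/
def hatRho (ρ : List ℕ) : List ℕ :=
  if h : ∃ σ, Yamanouchi σ ∧ CKEquiv ρ σ then h.choose else []

/-- The weak Edelman–Greene insertion tableau of a word: the weak descent tableau of the
unique Yamanouchi reduced word Coxeter–Knuth equivalent to it. -/
def hatP (ρ : List ℕ) : Tableau := weakDesTab (hatRho ρ)

/-! ### Factorizations -/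

/-- The factorization `f : ℕ → List ℕ` stores the block `ρ^{(i)}` at index `i ≥ 1`
(blocks indexed from the right); the largest index of a nonempty block. -/
def topIdx (f : ℕ → List ℕ) : ℕ := sSup {i : ℕ | f i ≠ []}

/-- The concatenation `ρ^{(top)} ⋯ ρ^{(i+1)} ρ^{(i)}` of the blocks of `f` with index `≥ i`. -/
def factWordGe (f : ℕ → List ℕ) (i : ℕ) : List ℕ :=
  ((((List.range (topIdx f + 1)).reverse).filter (fun j => decide (i ≤ j))).map f).foldr
    (· ++ ·) []

/-- The underlying word of a factorization. -/
def factWord (f : ℕ → List ℕ) : List ℕ := factWordGe f 0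

/-- The weak Edelman–Greene recording tableau of a factorization: it has the same shape as
the weak EG insertion tableau of the underlying word, and has entry `i` in all boxes of
`P̂(ρ^{(k)}|⋯|ρ^{(i)})` that are not in `P̂(ρ^{(k)}|⋯|ρ^{(i+1)})`. -/
def hatQfact (f : ℕ → List ℕ) : Tableau := fun r c =>
  sSup {i : ℕ | 1 ≤ i ∧ hatP (factWordGe f i) r c ≠ 0 ∧ hatP (factWordGe f (i + 1)) r c = 0}

/-- Every block is strictly increasing. -/
def IncreasingFact (f : ℕ → List ℕ) : Prop := ∀ i, List.Chain' (· < ·) (f i)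

/-- The factorization is `φ`-flagged: every nonempty block `ρ^{(i)}` has first letter
`ρ^{(i)}_1` with `φ(ρ^{(i)}_1) ≥ i`. -/
def FlaggedFact (φ : ℕ → ℕ) (f : ℕ → List ℕ) : Prop :=
  ∀ i, f i ≠ [] → i ≤ φ ((f i).headI)

/-- `RFC(w, φ)`: all `φ`-flagged increasing factorizations of reduced words for `w`. -/
def RFCset (w : Equiv.Perm ℕ) (φ : ℕ → ℕ) : Set (ℕ → List ℕ) :=
  {f | f 0 = [] ∧ {i : ℕ | f i ≠ []}.Finite ∧ IncreasingFact f ∧ FlaggedFact φ f ∧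
       IsReducedWordFor w (factWord f)}

/-- `RF_n(w)`: increasing factorizations of reduced words for `w` with exactly `n` blocks
(indexed `1, …, n`, possibly empty). -/
def RFn (n : ℕ) (w : Equiv.Perm ℕ) : Set (ℕ → List ℕ) :=
  {f | f 0 = [] ∧ (∀ j, n < j → f j = []) ∧ IncreasingFact f ∧
       IsReducedWordFor w (factWord f)}

/-- `RFC_n(w, φ)`: the `φ`-flagged elements of `RF_n(w)`. -/
def RFCn (n : ℕ) (w : Equiv.Perm ℕ) (φ : ℕ → ℕ) : Set (ℕ → List ℕ) :=
  {f | f ∈ RFn n w ∧ FlaggedFact φ f}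

/-! ### Morse–Schilling crystal operators -/

/-- Pairing procedure: first argument is the block `r^{(i)}` in *decreasing* order, second is
the not-yet-paired part of the block `r^{(i+1)}` (in increasing order). Each letter `b` of
`r^{(i)}`, from largest to smallest, is paired with the smallest still unpaired letter of
`r^{(i+1)}` strictly larger than `b`. Returns the unpaired letters of `r^{(i+1)}`. -/
def unpairedUpper : List ℕ → List ℕ → List ℕ
  | [], A => A
  | b :: bs, A =>
    match A.find? (fun a => decide (b < a)) with
    | some a => unpairedUpper bs (A.erase a)
    | none => unpairedUpper bs A

/-- As in `unpairedUpper`, but returns the unpaired letters of `r^{(i)}`. -/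
def unpairedLower : List ℕ → List ℕ → List ℕ
  | [], _ => []
  | b :: bs, A =>
    match A.find? (fun a => decide (b < a)) with
    | some a => unpairedLower bs (A.erase a)
    | none => b :: unpairedLower bs A

/-- Insert a letter into a weakly increasing list, keeping it increasing. -/
def insAsc (x : ℕ) : List ℕ → List ℕ
  | [] => [x]
  | y :: ys => if x ≤ y then x :: y :: ys else y :: insAsc x ys

/-- The Morse–Schilling raising operator `e_i`: if every letter of block `i+1` is paired,
the result is `none` (i.e. `0`); otherwise the largest unpaired letter `a` of block `i+1` is
removed and `a + s` is added to block `i`, where `s = min {j ≥ 0 | a+j+1 ∉ r^{(i+1)}}`. -/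
def msE (i : ℕ) (f : ℕ → List ℕ) : Option (ℕ → List ℕ) :=
  let B := f i
  let A := f (i + 1)
  let L := unpairedUpper B.reverse A
  if L = [] then none
  else
    let a := L.foldr max 0
    let s := sInf {j : ℕ | (a + j + 1) ∉ A}
    some (Function.update (Function.update f (i + 1) (A.erase a)) i (insAsc (a + s) B))

/-- The Morse–Schilling lowering operator `f_i`: if every letter of block `i` is paired,
the result is `none`; otherwise the smallest unpaired letter `b` of block `i` is removed and
`b - t` is added to block `i+1`, where `t = min {j ≥ 0 | b-j-1 ∉ r^{(i)}}`. -/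
def msF (i : ℕ) (f : ℕ → List ℕ) : Option (ℕ → List ℕ) :=
  let B := f i
  let A := f (i + 1)
  let R := unpairedLower B.reverse A
  if R = [] then none
  else
    let b := R.foldr min R.headI
    let t := sInf {j : ℕ | (b - j - 1) ∉ B}
    some (Function.update (Function.update f i (B.erase b)) (i + 1) (insAsc (b - t) A))

/-- Iteration `e_j^k` of the raising operator. -/
def msEIter (j : ℕ) : ℕ → (ℕ → List ℕ) → Option (ℕ → List ℕ)
  | 0, f => some f
  | k + 1, f => (msE j f).bind (msEIter j k)

/-- The Demazure operator `𝔇_j` on subsets of the crystal `RF_n(w)`: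
`𝔇_j X = {b ∈ RF_n(w) | e_j^k(b) ∈ X for some k ≥ 0}`. -/
def demOp (n : ℕ) (w : Equiv.Perm ℕ) (j : ℕ) (X : Set (ℕ → List ℕ)) : Set (ℕ → List ℕ) :=
  {b | b ∈ RFn n w ∧ ∃ (k : ℕ) (c : ℕ → List ℕ), msEIter j k b = some c ∧ c ∈ X}

/-- `𝔇_{i_1} 𝔇_{i_2} ⋯ 𝔇_{i_k} X` for a word `i_1 i_2 ⋯ i_k` (the head is applied last). -/
def demWord (n : ℕ) (w : Equiv.Perm ℕ) : List ℕ → Set (ℕ → List ℕ) → Set (ℕ → List ℕ)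
  | [], X => X
  | j :: rest, X => demOp n w j (demWord n w rest X)

/-- `𝔇_{b↓a} = 𝔇_{b-1} 𝔇_{b-2} ⋯ 𝔇_a` (the identity when `b ≤ a`). -/
def demDown (n : ℕ) (w : Equiv.Perm ℕ) (b a : ℕ) (X : Set (ℕ → List ℕ)) :
    Set (ℕ → List ℕ) :=
  demWord n w ((List.range' a (b - a)).reverse) X

/-! ### Key tableaux -/

/-- A key tableau: a filling of a left-justified diagram in the positively indexed rows,
with positive entries, weakly decreasing rows, distinct column entries, and the key
condition (c) of Assaf–Schilling. -/
def IsKeyTableau (T : Tableau) : Prop :=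
  (∀ (r : ℤ) (c : ℕ), r ≤ 0 → T r c = 0) ∧
  (∀ r : ℤ, T r 0 = 0) ∧
  {p : ℤ × ℕ | T p.1 p.2 ≠ 0}.Finite ∧
  (∀ (r : ℤ) (c : ℕ), 1 ≤ c → T r (c + 1) ≠ 0 → T r c ≠ 0) ∧
  (∀ (r : ℤ) (c : ℕ), 1 ≤ c → T r (c + 1) ≠ 0 → T r (c + 1) ≤ T r c) ∧
  (∀ (r r' : ℤ) (c : ℕ), r ≠ r' → T r c ≠ 0 → T r' c ≠ 0 → T r c ≠ T r' c) ∧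
  (∀ (r r' : ℤ) (c : ℕ), r < r' → T r c ≠ 0 → T r' c ≠ 0 → T r' c < T r c →
      T r (c + 1) ≠ 0 ∧ T r' c < T r (c + 1))

/-- The tableau is `φ`-flagged: every entry in row `i` is at most `φ(i)`. -/
def FlaggedTab (φ : ℕ → ℕ) (T : Tableau) : Prop := ∀ (i c : ℕ), T (i : ℤ) c ≤ φ i

/-- `SSKT(α, φ)`: the `φ`-flagged key tableaux of shape `α`. -/
def SSKT (α φ : ℕ → ℕ) : Set Tableau :=
  {T | IsKeyTableau T ∧ shapeOf T = α ∧ FlaggedTab φ T}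

/-- The weight of a tableau: `wt(T)_v` is the number of entries equal to `v`. -/
def wtTab (T : Tableau) : ℕ → ℕ := fun v =>
  if v = 0 then 0 else Set.ncard {p : ℤ × ℕ | T p.1 p.2 = v}

/-- The weight of a word: the multiplicity of each positive letter. -/
def wtWord (u : List ℕ) : ℕ → ℕ := fun v => if v = 0 then 0 else u.count v

/-- The statistic `m_i(col(T), j)` where position `j` of the reverse column reading word
(entries read down columns, from right to left) is the box in row `r`, column `c`:
the number of entries `i+1` weakly after this box minus the number of entries `i`. -/
def mi (T : Tableau) (i : ℕ) (r : ℤ) (c : ℕ) : ℤ :=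
  (Set.ncard {p : ℤ × ℕ | T p.1 p.2 = i + 1 ∧ (p.2 < c ∨ (p.2 = c ∧ p.1 ≤ r))} : ℤ) -
  (Set.ncard {p : ℤ × ℕ | T p.1 p.2 = i ∧ (p.2 < c ∨ (p.2 = c ∧ p.1 ≤ r))} : ℤ)

/-- The box `(r, c)` maximizes `m_i` among all boxes of `T`. -/
def isMaxBox (T : Tableau) (i : ℕ) (r : ℤ) (c : ℕ) : Prop :=
  T r c ≠ 0 ∧ ∀ (r' : ℤ) (c' : ℕ), T r' c' ≠ 0 → mi T i r' c' ≤ mi T i r c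

/-- The Assaf–Schilling raising operator `e_i` on key tableaux.  If `m_i(col(T)) ≤ 0` the
result is `none` (i.e. `0`); otherwise, with `q` the largest position of the reverse column
reading word achieving the maximum (i.e. the maximizing box with the smallest column index,
and the smallest row index in that column), all entries `i+1` in the row of `q` weakly to its
right are changed to `i`, and all entries `i` in the same columns as these entries are
changed to `i+1`. -/
def keyE (i : ℕ) (T : Tableau) : Option Tableau :=
  if h : ∃ (r : ℤ) (c : ℕ), isMaxBox T i r c ∧ 1 ≤ mi T i r c then
    let cq := sInf {c : ℕ | ∃ r : ℤ, isMaxBox T i r c}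
    let rq : ℤ := ((sInf {m : ℕ | isMaxBox T i ((m : ℕ) : ℤ) cq} : ℕ) : ℤ)
    some (fun r c =>
      if cq ≤ c ∧ T rq c = i + 1 then
        (if T r c = i + 1 then i else if T r c = i then i + 1 else T r c)
      else T r c)
  else none

/-- The Assaf–Schilling lowering operator `f_i`: the (unique) inverse of `e_i`. -/
def keyF (i : ℕ) (T : Tableau) : Option Tableau :=
  if h : ∃ T', keyE i T' = some T then some h.choose else none

/-- Restriction of a partially defined crystal operator to a subset: the operator returns
`none` (i.e. `0`) whenever it would leave the subset. -/
def restrictOp {β : Type} (S : Set β) (op : β → Option β) (x : β) : Option β :=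
  (op x).bind fun y => if y ∈ S then some y else none

/-! ### Polynomials: divided differences and key polynomials -/

/-- The divided difference operator `∂_i f = (f - s_i · f) / (x_i - x_{i+1})`. -/
def divDiff (i : ℕ) (fp : MvPolynomial ℕ ℤ) : MvPolynomial ℕ ℤ :=
  if h : ∃ g : MvPolynomial ℕ ℤ,
      g * (MvPolynomial.X i - MvPolynomial.X (i + 1)) =
        fp - MvPolynomial.rename (fun j => sPerm i j) fp
  then h.choose else 0

/-- The isobaric divided difference operator `π_i f = ∂_i (x_i f)`. -/
def piOp (i : ℕ) (fp : MvPolynomial ℕ ℤ) : MvPolynomial ℕ ℤ :=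
  divDiff i (MvPolynomial.X i * fp)

/-- `π_{i_1} π_{i_2} ⋯ π_{i_k} f` for a word `i_1 i_2 ⋯ i_k` (the head is applied last). -/
def piWord : List ℕ → MvPolynomial ℕ ℤ → MvPolynomial ℕ ℤ
  | [], fp => fp
  | i :: rest, fp => piOp i (piWord rest fp)

/-- `π_{b↓a} = π_{b-1} π_{b-2} ⋯ π_a` (the identity when `b ≤ a`). -/
def piDown (b a : ℕ) (fp : MvPolynomial ℕ ℤ) : MvPolynomial ℕ ℤ :=
  piWord ((List.range' a (b - a)).reverse) fp

/-- The conjugate of a weak composition: `conjC α t = #{j ≥ 1 | α_j ≥ t}` for `t ≥ 1`. -/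
def conjC (α : ℕ → ℕ) (t : ℕ) : ℕ :=
  Set.ncard {j : ℕ | 1 ≤ j ∧ 1 ≤ t ∧ t ≤ α j}

/-- The partition rearrangement of a weak composition (the conjugate of its conjugate). -/
def sortC (α : ℕ → ℕ) : ℕ → ℕ := conjC (conjC α)

/-- The length of a permutation: the common length of its reduced words. -/
def permLength (w : Equiv.Perm ℕ) : ℕ :=
  sInf {n : ℕ | ∃ ρ : List ℕ, PosWord ρ ∧ wordPerm ρ = w ∧ ρ.length = n}

/-- The monomial `x^β = x_1^{β_1} x_2^{β_2} ⋯`. -/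
def xExp (β : ℕ → ℕ) : MvPolynomial ℕ ℤ :=
  ∏ i ∈ Finset.range (sSup {n : ℕ | β n ≠ 0} + 1), MvPolynomial.X i ^ β i

/-- The key polynomial `κ_α = π_w x^λ` where `λ` is the partition rearrangement of `α` and
`w` is the minimal-length permutation of `S∞` with `α · w = λ`. -/
def keyPoly (α : ℕ → ℕ) : MvPolynomial ℕ ℤ :=
  if h : ∃ (ρ : List ℕ) (w : Equiv.Perm ℕ), IsReducedWordFor w ρ ∧
      (∀ i, α (w i) = sortC α i) ∧
      (∀ v : Equiv.Perm ℕ, (∃ τ, IsReducedWordFor v τ) → (∀ i, α (v i) = sortC α i) →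
        permLength w ≤ permLength v)
  then piWord h.choose (xExp (sortC α)) else 0

/-- The `φ`-flagged key polynomial `κ_{(α,φ)} = Σ_{T ∈ SSKT(α,φ)} x^{wt(T)}`. -/
def flaggedKeyPoly (α φ : ℕ → ℕ) : MvPolynomial ℕ ℤ :=
  ∑ᶠ T ∈ SSKT α φ, xExp (wtTab T)

/-! ### Column insertion, keys, standardization -/

/-- The number of boxes in column `c` of a tableau. -/
def colHeightN (T : Tableau) (c : ℕ) : ℕ := Set.ncard {r : ℤ | T r c ≠ 0}

/-- One pass of column insertion: insert the value `x` starting at column `c`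
(`fuel` bounds the number of columns visited). -/
def colInsertAux : ℕ → Tableau → ℕ → ℕ → Tableau
  | 0, T, _, _ => T
  | fuel + 1, T, c, x =>
    if ∀ r : ℤ, T r c ≠ 0 → T r c < x then
      -- x is greater than every entry of column c: place it at the end of the column
      fun r c' => if c' = c ∧ r = (colHeightN T c + 1 : ℤ) then x else T r c'
    else if ∃ r : ℤ, T r c = x then
      -- column c contains x: move on to the next column with the same value
      colInsertAux fuel T (c + 1) x
    else
      -- bump the smallest entry of column c that is larger than x
      let y := sInf {v : ℕ | x < v ∧ ∃ r : ℤ, T r c = v}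
      colInsertAux fuel (fun r c' => if c' = c ∧ T r c' = y then x else T r c') (c + 1) y

/-- Column insertion of `x` into the semistandard Young tableau `T`. -/
def colInsert (T : Tableau) (x : ℕ) : Tableau :=
  colInsertAux (sSup {c : ℕ | ∃ r : ℤ, T r c ≠ 0} + 2) T 1 x

/-- The insertion tableau `P` of `(v → ∅)`: successively column insert
`v_n, v_{n-1}, …, v_1` into the empty tableau. -/
def insertP (v : List ℕ) : Tableau :=
  v.reverse.foldl colInsert (fun _ _ => 0)

/-- The recording tableau `Q` of `(v → ∅)`: the standard Young tableau whose restriction to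
`{1, …, j}` has the same shape as the insertion tableau of the last `j` letters of `v`. -/
def insertQ (v : List ℕ) : Tableau := fun r c =>
  sInf {j : ℕ | insertP (v.drop (v.length - j)) r c ≠ 0}

/-- The key `key(α)`: the unique semistandard Young tableau of weight `α` such that the set
of entries of column `i+1` is a subset of the entries of column `i`; its column `c` consists
of the elements of `{x ≥ 1 | α_x ≥ c}` in increasing order from bottom to top. -/
def keyTab (α : ℕ → ℕ) : Tableau := fun r c =>
  if c = 0 then 0
  else sInf {x : ℕ | 1 ≤ x ∧ c ≤ α x ∧
    ((Set.ncard {y : ℕ | 1 ≤ y ∧ c ≤ α y ∧ y ≤ x} : ℕ) : ℤ) = r}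

/-- The standardization of a semistandard Young tableau: the `1`'s are replaced from left to
right by `1, …, β_1`, the `2`'s by `β_1 + 1, …, β_1 + β_2`, and so on. -/
def stdTab (T : Tableau) : Tableau := fun r c =>
  if T r c = 0 then 0
  else Set.ncard {p : ℤ × ℕ |
    T p.1 p.2 ≠ 0 ∧ (T p.1 p.2 < T r c ∨ (T p.1 p.2 = T r c ∧ p.2 ≤ c))}

/-! ### Maximal factorizations (Reiner–Shimozono) -/

/-- Every block is weakly increasing. -/
def WeaklyIncrFact (g : ℕ → List ℕ) : Prop := ∀ i, List.Chain' (· ≤ ·) (g i)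

/-- Maximality: the nonempty blocks have maximal length, i.e. there is a strict descent
between any two consecutive nonempty blocks (no letter can be moved from the end of a block
to the front of the next one to the right). -/
def MaxFact (g : ℕ → List ℕ) : Prop :=
  ∀ i j : ℕ, 1 ≤ i → i < j → g i ≠ [] → g j ≠ [] → (∀ m, i < m → m < j → g m = []) →
    (g i).headI < (g j).getLastD 0

/-- Reiner–Shimozono's set `𝒲(α, φ)` of `φ`-flagged maximal factorizations
`u^• = u^n ⋯ u^2 u^1` with `ℓ(u^i) = α_i` and `(u → ∅) = (P, std(key(α)))`. -/
def Wset (α φ : ℕ → ℕ) : Set (ℕ → List ℕ) :=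
  {g | g 0 = [] ∧ (∀ i, (g i).length = α i) ∧ (∀ i, ∀ x ∈ g i, 1 ≤ x) ∧
       WeaklyIncrFact g ∧ MaxFact g ∧ (∀ i, ∀ x ∈ g i, x ≤ φ i) ∧
       insertQ (factWord g) = stdTab (keyTab α)}

/-! ### Shifts and highest weight key tableaux -/

/-- `shift_N`: add `N` to every letter of every block. -/
def shiftFact (N : ℕ) (f : ℕ → List ℕ) : ℕ → List ℕ := fun i => (f i).map (· + N)

/-- The tableau of shape `α` whose column `i` is filled by `1, 2, …, λ^T_i` in increasing
order from bottom to top (where `λ^T` is the conjugate of the partition rearrangement `λ`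
of `α`): the box of column `c` in row `m` (where `α_m ≥ c`) contains the number of indices
`m' ≤ m` with `α_{m'} ≥ c`. -/
def highKeyTab (α : ℕ → ℕ) : Tableau := fun r c =>
  if c = 0 then 0
  else if ∃ m : ℕ, (m : ℤ) = r ∧ 1 ≤ m ∧ c ≤ α m then
    Set.ncard {m : ℕ | 1 ≤ m ∧ c ≤ α m ∧ (m : ℤ) ≤ r}
  else 0


/-- A `gl_n`-crystal isomorphism between two sets of key tableaux, both equipped with the
Assaf–Schilling operators (restricted to the sets): a weight-preserving bijection commuting
with all raising and lowering operators `e_i, f_i` for `1 ≤ i < n`. -/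
def SSKTIso (n : ℕ) (S₁ S₂ : Set Tableau) : Prop :=
  ∃ g : Tableau → Tableau, Set.BijOn g S₁ S₂ ∧
    (∀ T ∈ S₁, wtTab T = wtTab (g T)) ∧
    ∀ T ∈ S₁, ∀ i : ℕ, 1 ≤ i → i < n →
      Option.map g (restrictOp S₁ (keyE i) T) = restrictOp S₂ (keyE i) (g T) ∧
      Option.map g (restrictOp S₁ (keyF i) T) = restrictOp S₂ (keyF i) (g T)

end

/-! ### Coxeter–Knuth equivalence and reduced words -/

namespace CKEquiv

theorem refl (u : List ℕ) : CKEquiv u u := Relation.EqvGen.refl u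

theorem symm {u v : List ℕ} (h : CKEquiv u v) : CKEquiv v u := Relation.EqvGen.symm _ _ h

theorem trans {u v w : List ℕ} (h : CKEquiv u v) (h' : CKEquiv v w) : CKEquiv u w :=
  Relation.EqvGen.trans _ _ _ h h'

end CKEquiv

theorem CKStep.append (a b : List ℕ) {u v : List ℕ} (h : CKStep u v) :
    CKStep (a ++ u ++ b) (a ++ v ++ b) := by
  rcases h with ⟨c, d, x, y, z, h1, h2, rfl, rfl⟩ | ⟨c, d, x, y, z, h1, h2, rfl, rfl⟩ |
    ⟨c, d, i, rfl, rfl⟩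
  · exact Or.inl ⟨a ++ c, d ++ b, x, y, z, h1, h2, by simp, by simp⟩
  · exact Or.inr (Or.inl ⟨a ++ c, d ++ b, x, y, z, h1, h2, by simp, by simp⟩)
  · exact Or.inr (Or.inr ⟨a ++ c, d ++ b, i, by simp, by simp⟩)

namespace CKEquiv

theorem infix_congr (a b : List ℕ) {u v : List ℕ} (h : CKEquiv u v) :
    CKEquiv (a ++ u ++ b) (a ++ v ++ b) := by
  induction h with
  | rel _ _ h => exact Relation.EqvGen.rel _ _ (h.append a b)
  | refl _ => exact refl _
  | symm _ _ _ ih => exact ih.symm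
  | trans _ _ _ _ _ ih1 ih2 => exact ih1.trans ih2

theorem left (a : List ℕ) {u v : List ℕ} (h : CKEquiv u v) : CKEquiv (a ++ u) (a ++ v) := by
  simpa using h.infix_congr a []

theorem right (b : List ℕ) {u v : List ℕ} (h : CKEquiv u v) : CKEquiv (u ++ b) (v ++ b) := by
  simpa using h.infix_congr [] b

theorem cons (a : ℕ) {u v : List ℕ} (h : CKEquiv u v) : CKEquiv (a :: u) (a :: v) :=
  h.left [a]

theorem append {u v u' v' : List ℕ} (h : CKEquiv u v) (h' : CKEquiv u' v') :
    CKEquiv (u ++ u') (v ++ v') :=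
  (h.right u').trans (h'.left v)

theorem of_eq {u v : List ℕ} (h : u = v) : CKEquiv u v := h ▸ refl u

theorem swap_right {x y z : ℕ} (h1 : y < x) (h2 : x < z) : CKEquiv [x, y, z] [x, z, y] :=
  Relation.EqvGen.rel _ _ (Or.inl ⟨[], [], x, y, z, h1, h2, rfl, rfl⟩)

theorem swap_left {x y z : ℕ} (h1 : y < z) (h2 : z < x) : CKEquiv [x, y, z] [y, x, z] :=
  Relation.EqvGen.rel _ _ (Or.inr (Or.inl ⟨[], [], x, y, z, h1, h2, rfl, rfl⟩))

theorem braid (i : ℕ) : CKEquiv [i, i + 1, i] [i + 1, i, i + 1] :=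
  Relation.EqvGen.rel _ _ (Or.inr (Or.inr ⟨[], [], i, rfl, rfl⟩))

theorem mem_iff {u v : List ℕ} (h : CKEquiv u v) (x : ℕ) : x ∈ u ↔ x ∈ v := by
  induction h with
  | rel _ _ h =>
    rcases h with ⟨c, d, x, y, z, h1, h2, rfl, rfl⟩ | ⟨c, d, x, y, z, h1, h2, rfl, rfl⟩ |
      ⟨c, d, i, rfl, rfl⟩ <;> simp <;> tauto
  | refl _ => rfl
  | symm _ _ _ ih => exact ih.symm
  | trans _ _ _ _ _ ih1 ih2 => exact ih1.trans ih2

theorem length_eq {u v : List ℕ} (h : CKEquiv u v) : u.length = v.length := by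
  induction h with
  | rel _ _ h =>
    rcases h with ⟨c, d, x, y, z, h1, h2, rfl, rfl⟩ | ⟨c, d, x, y, z, h1, h2, rfl, rfl⟩ |
      ⟨c, d, i, rfl, rfl⟩ <;> simp
  | refl _ => rfl
  | symm _ _ _ ih => exact ih.symm
  | trans _ _ _ _ _ ih1 ih2 => exact ih1.trans ih2

end CKEquiv

theorem sPerm_mul_self (i : ℕ) : sPerm i * sPerm i = 1 := Equiv.swap_mul_self i (i + 1)

theorem sPerm_comm {i j : ℕ} (h : i + 1 < j) : sPerm i * sPerm j = sPerm j * sPerm i := by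
  apply Equiv.Perm.Disjoint.commute
  intro x
  simp only [sPerm]
  by_cases hx : x = i ∨ x = i + 1
  · right
    apply Equiv.swap_apply_of_ne_of_ne <;> omega
  · left
    apply Equiv.swap_apply_of_ne_of_ne <;> omega

theorem sPerm_braid (i : ℕ) :
    sPerm i * sPerm (i + 1) * sPerm i = sPerm (i + 1) * sPerm i * sPerm (i + 1) := by
  have e1 := Equiv.swap_mul_swap_mul_swap (x := i + 2) (y := i + 1) (z := i) (by omega) (by omega)
  have e2 := Equiv.swap_mul_swap_mul_swap (x := i) (y := i + 1) (z := i + 2) (by omega) (by omega)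
  rw [Equiv.swap_comm (i + 1) i, Equiv.swap_comm (i + 2) (i + 1)] at e1
  rw [Equiv.swap_comm (i + 2) i] at e2
  simp only [sPerm, show i + 1 + 1 = i + 2 from rfl]
  rw [e1, e2]

@[simp] theorem wordPerm_nil : wordPerm [] = 1 := rfl

@[simp] theorem wordPerm_cons (a : ℕ) (u : List ℕ) :
    wordPerm (a :: u) = sPerm a * wordPerm u := by simp [wordPerm]

@[simp] theorem wordPerm_append (u v : List ℕ) :
    wordPerm (u ++ v) = wordPerm u * wordPerm v := by simp [wordPerm]

theorem CKEquiv.wordPerm_eq {u v : List ℕ} (h : CKEquiv u v) : wordPerm u = wordPerm v := by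
  induction h with
  | rel _ _ h =>
    rcases h with ⟨c, d, x, y, z, h1, h2, rfl, rfl⟩ | ⟨c, d, x, y, z, h1, h2, rfl, rfl⟩ |
      ⟨c, d, i, rfl, rfl⟩
    · have := sPerm_comm (show y + 1 < z by omega)
      simp only [wordPerm_append, wordPerm_cons, wordPerm_nil, mul_one]
      rw [this]
    · have := sPerm_comm (show y + 1 < x by omega)
      simp only [wordPerm_append, wordPerm_cons, wordPerm_nil, mul_one, ← mul_assoc]
      rw [mul_assoc _ (sPerm x), ← this, ← mul_assoc]
    · have := sPerm_braid i
      simp only [wordPerm_append, wordPerm_cons, wordPerm_nil, mul_one]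
      rw [← mul_assoc (sPerm i), this, mul_assoc (sPerm (i+1))]
  | refl _ => rfl
  | symm _ _ _ ih => exact ih.symm
  | trans _ _ _ _ _ ih1 ih2 => exact ih1.trans ih2

theorem IsReducedWord.of_ck {u v : List ℕ} (hu : IsReducedWord u) (h : CKEquiv u v) :
    IsReducedWord v := by
  refine ⟨fun x hx => hu.1 x ((h.mem_iff x).2 hx), fun σ hσ he => ?_⟩
  rw [← h.length_eq]
  exact hu.2 σ hσ (he.trans h.wordPerm_eq.symm)

theorem IsReducedWord.of_infix {a u b : List ℕ} (h : IsReducedWord (a ++ u ++ b)) :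
    IsReducedWord u := by
  refine ⟨fun x hx => h.1 x (by simp [hx]), fun σ hσ he => ?_⟩
  have := h.2 (a ++ σ ++ b) ?_ (by simp [he])
  · simp at this
    omega
  · intro x hx
    simp only [List.mem_append] at hx
    rcases hx with (hx | hx) | hx
    · exact h.1 x (by simp [hx])
    · exact hσ x hx
    · exact h.1 x (by simp [hx])

theorem IsReducedWord.of_append_left {u b : List ℕ} (h : IsReducedWord (u ++ b)) :
    IsReducedWord u := IsReducedWord.of_infix (a := []) (b := b) (by simpa using h)

theorem IsReducedWord.of_append_right {a u : List ℕ} (h : IsReducedWord (a ++ u)) :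
    IsReducedWord u := IsReducedWord.of_infix (a := a) (b := []) (by simpa using h)

/-- The descending word `p + n, …, p + 1, p`. -/
def runD (p : ℕ) : ℕ → List ℕ
  | 0 => [p]
  | n + 1 => (p + n + 1) :: runD p n

theorem mem_runD {p n x : ℕ} : x ∈ runD p n ↔ p ≤ x ∧ x ≤ p + n := by
  induction n with
  | zero => simp [runD]; omega
  | succ n ih => simp [runD, ih]; omega

theorem runD_pairwise (p n : ℕ) : (runD p n).Pairwise (· > ·) := by
  induction n with
  | zero => simp [runD]
  | succ n ih =>
    refine List.pairwise_cons.2 ⟨fun x hx => ?_, ih⟩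
    rw [mem_runD] at hx
    omega

theorem wordPerm_comm_of_far {u v : List ℕ} (h : ∀ x ∈ u, ∀ y ∈ v, x + 1 < y) :
    wordPerm u * wordPerm v = wordPerm v * wordPerm u := by
  induction u with
  | nil => simp
  | cons a u ih =>
    have h1 : ∀ v : List ℕ, (∀ y ∈ v, a + 1 < y) → sPerm a * wordPerm v = wordPerm v * sPerm a := by
      intro v hv
      induction v with
      | nil => simp
      | cons b v ih2 =>
        have := ih2 (fun y hy => hv y (by simp [hy]))
        rw [wordPerm_cons, ← mul_assoc, sPerm_comm (hv b (by simp)), mul_assoc, this, mul_assoc]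
    rw [wordPerm_cons, mul_assoc, ih (fun x hx => h x (by simp [hx])), ← mul_assoc,
      h1 v (h a (by simp)), mul_assoc]

theorem runD_sq_shorter (p n : ℕ) (hp : 1 ≤ p) : ∃ w : List ℕ, PosWord w ∧
    wordPerm w = wordPerm (runD p n) * wordPerm (runD p n) ∧ w.length < 2 * (n + 1) := by
  induction n with
  | zero => exact ⟨[], by simp [PosWord], by simp [runD, sPerm_mul_self], by simp⟩
  | succ n ih =>
    obtain ⟨w, hw, he, hl⟩ := ih
    refine ⟨(p + n) :: (p + n + 1) :: w, ?_, ?_, by simp; omega⟩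
    · intro x hx
      simp only [List.mem_cons] at hx
      rcases hx with rfl | rfl | hx
      · omega
      · omega
      · exact hw x hx
    · simp only [wordPerm_cons, he]
      cases n with
      | zero =>
        simp only [runD, wordPerm_cons, wordPerm_nil, mul_one, add_zero]
        have := sPerm_braid p
        simp only [← mul_assoc, this]
      | succ m =>
        have hc : wordPerm (runD p m) * sPerm (p + m + 2) =
            sPerm (p + m + 2) * wordPerm (runD p m) := by
          have := @wordPerm_comm_of_far (runD p m) [p + m + 2] (by
            intro x hx y hy
            rw [mem_runD] at hx
            simp at hy
            omega)
          simpa using this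
        have hb := sPerm_braid (p + m + 1)
        simp only [runD, wordPerm_cons]
        rw [show p + (m + 1) + 1 = p + m + 2 by ring, show p + (m + 1) = p + m + 1 by ring]
        rw [show p + m + 1 + 1 = p + m + 2 by ring] at hb
        generalize wordPerm (runD p m) = D at *
        generalize sPerm (p + m + 1) = s at *
        generalize sPerm (p + m + 2) = t at *
        calc s * (t * (s * D * (s * D))) = (s * t * s) * D * s * D := by group
          _ = t * s * (t * D) * s * D := by rw [hb]; group
          _ = t * s * (D * t) * s * D := by rw [hc]
          _ = _ := by group

theorem runD_length (p n : ℕ) : (runD p n).length = n + 1 := by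
  induction n with
  | zero => rfl
  | succ n ih => simp [runD, ih]

theorem not_reduced_runD {p n : ℕ} {A B : List ℕ} (hA : ∀ x ∈ A, x + 1 < p)
    (hB : ∀ x ∈ B, p + n + 1 < x) : ¬ IsReducedWord (runD p n ++ A ++ B ++ runD p n) := by
  intro h
  have hp : 1 ≤ p := h.1 p (by simp [mem_runD])
  obtain ⟨w, hw, he, hl⟩ := runD_sq_shorter p n hp
  have h1 := wordPerm_comm_of_far (u := A) (v := runD p n) (fun x hx y hy => by
    rw [mem_runD] at hy; have := hA x hx; omega)
  have h2 := wordPerm_comm_of_far (u := runD p n) (v := B) (fun x hx y hy => by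
    rw [mem_runD] at hx; have := hB y hy; omega)
  have := h.2 (A ++ w ++ B) ?_ ?_
  · simp [runD_length] at this
    omega
  · intro x hx
    simp only [List.mem_append] at hx
    rcases hx with (hx | hx) | hx
    · exact h.1 x (by simp [hx])
    · exact hw x hx
    · exact h.1 x (by simp [hx])
  · simp only [wordPerm_append, he]
    rw [mul_assoc _ (wordPerm B), ← h2, ← h1]
    group

/-! ### Decreasing words of finite sets -/

/-- The strictly decreasing word of a finite set of letters. -/
def desc (A : Finset ℕ) : List ℕ := A.sort.reverse

theorem mem_desc {A : Finset ℕ} {x : ℕ} : x ∈ desc A ↔ x ∈ A := by simp [desc]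

theorem desc_pairwise (A : Finset ℕ) : (desc A).Pairwise (· > ·) := by
  rw [desc, List.pairwise_reverse]
  exact A.sortedLT_sort.pairwise

theorem desc_length (A : Finset ℕ) : (desc A).length = A.card := by simp [desc]

theorem desc_eq {A : Finset ℕ} {l : List ℕ} (hl : l.Pairwise (· > ·))
    (h : ∀ x, x ∈ l ↔ x ∈ A) : desc A = l := by
  have hp : (desc A).Perm l :=
    (List.perm_ext_iff_of_nodup ((desc_pairwise A).imp (fun h => ne_of_gt h))
      (hl.imp (fun h => ne_of_gt h))).2 (fun x => by rw [mem_desc, h])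
  exact hp.eq_of_pairwise (fun a b _ _ h1 h2 => by omega) (desc_pairwise A) hl

@[simp] theorem desc_empty : desc ∅ = [] := by simp [desc]

theorem desc_union {A B C : Finset ℕ} (h : ∀ x, x ∈ A ↔ x ∈ B ∨ x ∈ C)
    (hlt : ∀ x ∈ B, ∀ y ∈ C, y < x) : desc A = desc B ++ desc C := by
  apply desc_eq
  · rw [List.pairwise_append]
    exact ⟨desc_pairwise B, desc_pairwise C, fun x hx y hy =>
      hlt x (mem_desc.1 hx) y (mem_desc.1 hy)⟩
  · intro x
    rw [List.mem_append, mem_desc, mem_desc, h]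

theorem ck_push_left {a b : ℕ} (hab : a < b) (H L : List ℕ) (hH : (H ++ [b]).Pairwise (· > ·)) :
    CKEquiv (a :: (H ++ b :: L)) (H ++ a :: b :: L) := by
  induction H with
  | nil => exact CKEquiv.refl _
  | cons h H ih =>
    have hH' := List.pairwise_cons.1 hH
    refine CKEquiv.trans ?_ ((ih hH'.2).cons h)
    have key : ∀ c M, a < c → c < h → CKEquiv (a :: h :: c :: M) (h :: a :: c :: M) :=
      fun c M h1 h2 => (CKEquiv.swap_left h1 h2).symm.right M
    cases H with
    | nil => exact key b L hab (hH'.1 b (by simp))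
    | cons c H =>
      refine key c (H ++ b :: L) ?_ (hH'.1 c (by simp))
      exact hab.trans ((List.pairwise_cons.1 hH'.2).1 b (by simp))

theorem ck_push_right {a b : ℕ} (hab : a < b) (L : List ℕ) (hL : (a :: L).Pairwise (· > ·)) :
    CKEquiv (a :: b :: L) (a :: (L ++ [b])) := by
  induction L generalizing a with
  | nil => exact CKEquiv.refl _
  | cons l L ih =>
    have hL' := List.pairwise_cons.1 hL
    have h1 : l < a := hL'.1 l (by simp)
    exact ((CKEquiv.swap_right h1 hab).symm.right L).trans ((ih (h1.trans hab) hL'.2).cons a)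

theorem ck_bump {a b : ℕ} (hab : a < b) (H L : List ℕ) (hH : (H ++ [b]).Pairwise (· > ·))
    (hL : (a :: L).Pairwise (· > ·)) :
    CKEquiv (a :: (H ++ b :: L)) (H ++ a :: (L ++ [b])) :=
  (ck_push_left hab H L hH).trans ((ck_push_right hab L hL).left H)

theorem ck_bump_succ (a : ℕ) (H L : List ℕ) (hH : (H ++ [a + 1]).Pairwise (· > ·))
    (hL : (a :: L).Pairwise (· > ·)) :
    CKEquiv (a :: (H ++ (a + 1) :: a :: L)) (H ++ (a + 1) :: a :: (L ++ [a + 1])) := by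
  refine (ck_push_left (Nat.lt_succ_self a) H (a :: L) hH).trans (CKEquiv.left H ?_)
  exact ((CKEquiv.braid a).right L).trans ((ck_push_right (Nat.lt_succ_self a) L hL).cons (a + 1))

/-- Entrywise strict comparison of two increasing columns, the second not being taller. -/
def RowLT : List ℕ → List ℕ → Prop
  | _, [] => True
  | [], _ :: _ => False
  | x :: X, y :: Y => x < y ∧ RowLT X Y

theorem ck_insert_column (X Y H Z : List ℕ) (h : RowLT X Y)
    (hX : X.Pairwise (· < ·)) (hHY : (H ++ Y.reverse).Pairwise (· > ·))
    (hZ : Z.Pairwise (· > ·)) (hZX : ∀ z ∈ Z, ∀ x ∈ X, z < x)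
    (hc : X.length = Y.length ∨ H = []) :
    CKEquiv (X.reverse ++ (H ++ (Y.reverse ++ Z))) (H ++ (X.reverse ++ (Z ++ Y.reverse))) := by
  induction X generalizing Y Z with
  | nil =>
    cases Y with
    | nil => simpa using CKEquiv.refl _
    | cons y Y => exact absurd h id
  | cons x X ih =>
    cases Y with
    | nil =>
      rcases hc with hc | rfl
      · simp at hc
      · simpa using CKEquiv.refl _
    | cons y Y =>
      obtain ⟨hxy, hXY⟩ := h
      have hX' := List.pairwise_cons.1 hX
      have h1 : CKEquiv (x :: ((H ++ Y.reverse) ++ y :: Z))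
          ((H ++ Y.reverse) ++ x :: (Z ++ [y])) := by
        apply ck_bump hxy
        · simpa using hHY
        · exact List.pairwise_cons.2 ⟨fun z hz => hZX z hz x (by simp), hZ⟩
      have h2 := ih Y (x :: Z) hXY hX'.2 ?_ ?_ ?_ ?_
      · have h3 := h1.left X.reverse
        have h4 := h2.right [y]
        simp only [List.reverse_cons, List.append_assoc, List.cons_append, List.nil_append] at *
        exact h3.trans h4
      · refine hHY.sublist ?_
        simp
      · exact List.pairwise_cons.2 ⟨fun z hz => hZX z hz x (by simp), hZ⟩
      · intro z hz x' hx'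
        rcases List.mem_cons.1 hz with rfl | hz
        · exact hX'.1 x' hx'
        · exact hZX z hz x' (by simp [hx'])
      · rcases hc with hc | hc
        · left; simpa using hc
        · exact Or.inr hc

theorem runD_succ_eq (p n : ℕ) : runD p (n + 1) = runD (p + 1) n ++ [p] := by
  induction n with
  | zero => rfl
  | succ n ih =>
    rw [runD, ih, runD]
    simp; omega

theorem ck_insert_run (b t : ℕ) (H L : List ℕ) (h : (H ++ runD b (t + 1) ++ L).Pairwise (· > ·)) :
    CKEquiv (runD b t ++ (H ++ (runD b (t + 1) ++ L))) (H ++ (runD b (t + 1) ++ (L ++ runD (b +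
        1) t))) := by
  induction t generalizing b L with
  | zero =>
    have := ck_bump_succ b H L ?_ ?_
    · simpa [runD] using this
    · refine h.sublist ?_
      simp [runD]
    · refine h.sublist ?_
      simp [runD]
  | succ t ih =>
    have e1 : runD b (t + 2) = runD (b + 2) t ++ (b + 1) :: [b] := by
      rw [runD_succ_eq, runD_succ_eq (b + 1)]; simp
    have h1 : CKEquiv (b :: ((H ++ runD (b + 2) t) ++ (b + 1) :: b :: L))
      ((H ++ runD (b + 2) t) ++ (b + 1) :: b :: (L ++ [b + 1])) := by
      apply ck_bump_succ b
      · refine h.sublist ?_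
        simp [e1]
      · refine h.sublist ?_
        simp only [e1, List.append_assoc, List.cons_append, List.nil_append]
        refine List.Sublist.trans ?_ (List.sublist_append_right _ _)
        refine List.Sublist.trans ?_ (List.sublist_append_right _ _)
        simp
    have h2 := ih (b + 1) (b :: L) (by
      have := h
      rw [runD_succ_eq] at this
      simpa using this)
    have h3 := h1.left (runD (b + 1) t)
    have h4 := h2.right [b + 1]
    rw [runD_succ_eq b t, e1, runD_succ_eq (b + 1) t]
    rw [runD_succ_eq (b + 1) t] at h4
    simp only [List.append_assoc, List.cons_append, List.nil_append] at *
    exact h3.trans h4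

/-! ### Pairs of columns -/

/-- The number of letters of `A` below `q` minus the number of letters of `B` up to `q`. -/
def ht (A B : Finset ℕ) (q : ℕ) : ℤ :=
  ((A.filter (· < q)).card : ℤ) - ((B.filter (· ≤ q)).card : ℤ)

/-- `A` and `B` are the first and second columns of a tableau. -/
def Tab (A B : Finset ℕ) : Prop := ∀ q, 0 ≤ ht A B q

theorem ht_succ (A B : Finset ℕ) (q : ℕ) :
    ht A B (q + 1) = ht A B q + (if q ∈ A then 1 else 0) - (if q + 1 ∈ B then 1 else 0) := by
  have h1 : ((A.filter (· < q + 1)).card : ℤ) = (A.filter (· < q)).card +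
      (if q ∈ A then 1 else 0) := by
    split_ifs with h
    · rw [show A.filter (· < q + 1) = insert q (A.filter (· < q)) by
        ext x
        simp only [Finset.mem_filter, Finset.mem_insert]
        grind]
      rw [Finset.card_insert_of_notMem (by simp)]
      push_cast; ring
    · rw [show A.filter (· < q + 1) = A.filter (· < q) by
        ext x
        simp only [Finset.mem_filter]
        grind]
      simp
  have h2 : ((B.filter (· ≤ q + 1)).card : ℤ) = (B.filter (· ≤ q)).card + (if q +
      1 ∈ B then 1 else 0) := by
    split_ifs with h
    · rw [show B.filter (· ≤ q + 1) = insert (q + 1) (B.filter (· ≤ q)) by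
        ext x
        simp only [Finset.mem_filter, Finset.mem_insert]
        grind]
      rw [Finset.card_insert_of_notMem (by simp)]
      push_cast; ring
    · rw [show B.filter (· ≤ q + 1) = B.filter (· ≤ q) by
        ext x
        simp only [Finset.mem_filter]
        grind]
      simp
  simp only [ht, h1, h2]
  ring

theorem ht_zero_nonpos (A B : Finset ℕ) : ht A B 0 ≤ 0 := by
  simp [ht]

theorem ht_insert_left {A B : Finset ℕ} {a : ℕ} (ha : a ∉ A) (q : ℕ) :
    ht (insert a A) B q = ht A B q + (if a < q then 1 else 0) := by
  simp only [ht, Finset.filter_insert]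
  split_ifs with h
  · rw [Finset.card_insert_of_notMem (by simp [ha])]
    push_cast; ring
  · ring

theorem ht_erase_right {A B : Finset ℕ} {b : ℕ} (hb : b ∈ B) (q : ℕ) :
    ht A (B.erase b) q = ht A B q + (if b ≤ q then 1 else 0) := by
  simp only [ht, Finset.filter_erase]
  split_ifs with h
  · rw [Finset.card_erase_of_mem (by simp [hb, h])]
    have : 0 < (B.filter (· ≤ q)).card := Finset.card_pos.2 ⟨b, by simp [hb, h]⟩
    push_cast [Nat.cast_sub this]; ring
  · rw [Finset.erase_eq_of_notMem (by simp [h])]; ring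

theorem ht_erase_left {A B : Finset ℕ} {a : ℕ} (ha : a ∈ A) (q : ℕ) :
    ht (A.erase a) B q = ht A B q - (if a < q then 1 else 0) := by
  have := ht_insert_left (B := B) (Finset.notMem_erase a A) q
  rw [Finset.insert_erase ha] at this
  omega

theorem ht_insert_right {A B : Finset ℕ} {b : ℕ} (hb : b ∉ B) (q : ℕ) :
    ht A (insert b B) q = ht A B q - (if b ≤ q then 1 else 0) := by
  have := ht_erase_right (A := A) (Finset.mem_insert_self b B) q
  rw [Finset.erase_insert hb] at this
  omega

theorem ht_sdiff {A B C : Finset ℕ} (h : C ⊆ B) (q : ℕ) :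
    ht A C q = ht A B q + ((B \ C).filter (· ≤ q)).card := by
  have : (B.filter (· ≤ q)).card = (C.filter (· ≤ q)).card + ((B \ C).filter (· ≤ q)).card := by
    rw [← Finset.card_union_of_disjoint]
    · congr 1
      ext x
      simp only [Finset.mem_filter, Finset.mem_union, Finset.mem_sdiff]
      have := @h x
      tauto
    · rw [Finset.disjoint_left]
      simp only [Finset.mem_filter, Finset.mem_sdiff]
      tauto
  simp only [ht]
  omega

theorem card_filter_le_mono (S : Finset ℕ) {p q : ℕ} (h : p ≤ q) :
    (S.filter (· ≤ p)).card ≤ (S.filter (· ≤ q)).card :=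
  Finset.card_le_card (Finset.monotone_filter_right S (fun _ _ hx => le_trans hx h))

theorem Tab.mono {A B C : Finset ℕ} (h : Tab A B) (hC : C ⊆ B) : Tab A C := fun q => by
  rw [ht_sdiff hC]
  have := h q
  positivity

theorem tab_empty (A : Finset ℕ) : Tab A ∅ := fun q => by simp [ht]

open Classical in
/-- The letters of `A` that are matched with a letter of `B`. -/
noncomputable def matched (A B : Finset ℕ) : Finset ℕ :=
  A.filter fun a => ∃ q, a < q ∧ ht A B q ≤ ht A B a

theorem mem_matched {A B : Finset ℕ} {a : ℕ} :
    a ∈ matched A B ↔ a ∈ A ∧ ∃ q, a < q ∧ ht A B q ≤ ht A B a := by simp [matched]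

theorem matched_subset (A B : Finset ℕ) : matched A B ⊆ A := by
  intro x hx
  exact (mem_matched.1 hx).1

theorem matched_mono (A : Finset ℕ) {B C : Finset ℕ} (h : C ⊆ B) : matched A C ⊆ matched A B := by
  intro a ha
  obtain ⟨ha, q, hq, hle⟩ := mem_matched.1 ha
  refine mem_matched.2 ⟨ha, q, hq, ?_⟩
  rw [ht_sdiff h, ht_sdiff h] at hle
  have := card_filter_le_mono (B \ C) hq.le
  omega

theorem matched_empty (A : Finset ℕ) : matched A ∅ = ∅ := by
  ext a
  simp only [mem_matched, Finset.notMem_empty, iff_false, not_and, not_exists, not_le]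
  intro ha q hq
  simp only [ht, Finset.filter_empty, Finset.card_empty, Nat.cast_zero, sub_zero, Nat.cast_lt]
  apply Finset.card_lt_card
  rw [Finset.ssubset_iff_of_subset (Finset.monotone_filter_right A (fun _ _ hx => lt_trans hx hq))]
  exact ⟨a, by simp [ha, hq]⟩

theorem exists_argmin {f : ℕ → ℤ} (c : ℤ) (p : ℕ) (h : ∀ q, p ≤ q → c ≤ f q) :
    ∃ q, p ≤ q ∧ ∀ r, p ≤ r → f q ≤ f r := by
  obtain ⟨m, hm, hmin⟩ := Int.exists_least_of_bdd (P := fun z => ∃ q, p ≤ q ∧ f q = z)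
    ⟨c, by rintro z ⟨q, hq, rfl⟩; exact h q hq⟩ ⟨f p, p, le_rfl, rfl⟩
  obtain ⟨q, hq, rfl⟩ := hm
  exact ⟨q, hq, fun r hr => hmin _ ⟨r, hr, rfl⟩⟩

theorem exists_last_lt {P : ℕ → Prop} {n : ℕ} (h : ∃ x, x < n ∧ P x) :
    ∃ x, x < n ∧ P x ∧ ∀ y, x < y → y < n → ¬ P y := by
  classical
  induction n with
  | zero => obtain ⟨x, hx, _⟩ := h; omega
  | succ n ih =>
    by_cases hn : P n
    · exact ⟨n, by omega, hn, fun y h1 h2 => by omega⟩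
    · obtain ⟨x, hx, hPx⟩ := h
      have hne : x ≠ n := by rintro rfl; exact hn hPx
      obtain ⟨z, hz, hPz, hl⟩ := ih ⟨x, by omega, hPx⟩
      refine ⟨z, by omega, hPz, fun y h1 h2 => ?_⟩
      by_cases hy : y = n
      · subst hy; exact hn
      · exact hl y h1 (by omega)

theorem matched_erase {A P F : Finset ℕ} {p : ℕ} (hT : Tab A P) (hp : p ∈ P) (hF : F ⊆ P.erase p)
    (hlow : ∀ x ∈ P, x < p → x ∈ F) :
    ∃ p' ∈ matched A P, p' < p ∧ matched A (P.erase p) = (matched A P).erase p' ∧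
        matched A F ⊆ (matched A P).erase p' ∧
      ∀ x ∈ matched A P, x < p' → x ∈ matched A F := by
  obtain ⟨q0, hq0, hmin⟩ := exists_argmin (f := ht A P) 0 p (fun q _ => hT q)
  have h0 : ht A P 0 = 0 := le_antisymm (ht_zero_nonpos A P) (hT 0)
  have hp0 : 0 < p := by
    rcases Nat.eq_zero_or_pos p with rfl | h
    · exfalso
      have := ht_erase_right (A := A) hp 0
      have h2 := ht_zero_nonpos A (P.erase 0)
      simp at this
      omega
    · exact h
  obtain ⟨p', hp', hle, hlast⟩ := exists_last_lt (P := fun y => ht A P y ≤ ht A P q0)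
    ⟨0, hp0, by rw [h0]; exact hT q0⟩
  have hstep := ht_succ A P p'
  have hmem : p' ∈ A ∧ ht A P p' = ht A P q0 := by
    by_cases h : p' + 1 = p
    · have h1 := hmin p le_rfl
      rw [h, if_pos hp] at hstep
      split_ifs at hstep with hA
      · exact ⟨hA, by omega⟩
      · omega
    · have h1 := hlast (p' + 1) (by omega) (by omega)
      split_ifs at hstep with hA hB hB
      · omega
      · exact ⟨hA, by omega⟩
      · omega
      · omega
  have hmt : p' ∈ matched A P := mem_matched.2 ⟨hmem.1, q0, by omega, hmem.2.ge⟩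
  have herase : matched A (P.erase p) = (matched A P).erase p' := by
    ext a
    simp only [mem_matched, Finset.mem_erase]
    constructor
    · rintro ⟨ha, q, hq, hle'⟩
      rw [ht_erase_right hp, ht_erase_right hp] at hle'
      refine ⟨?_, ha, q, hq, ?_⟩
      · rintro rfl
        rw [if_neg (by omega : ¬ p ≤ a)] at hle'
        split_ifs at hle' with h
        · have := hmin q h; omega
        · exact hlast q hq (by omega) (by omega)
      · split_ifs at hle' <;> omega
    · rintro ⟨hne, ha, q, hq, hle'⟩
      refine ⟨ha, ?_⟩
      by_cases hpa : p ≤ a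
      · refine ⟨q, hq, ?_⟩
        rw [ht_erase_right hp, ht_erase_right hp, if_pos hpa, if_pos (by omega)]
        omega
      · by_cases hqp : p ≤ q
        · have h1 := hmin q hqp
          by_cases h2 : ht A P q0 < ht A P a
          · refine ⟨q0, by omega, ?_⟩
            rw [ht_erase_right hp, ht_erase_right hp, if_neg hpa, if_pos hq0]
            omega
          · have h3 : a < p' := by
              by_contra h3
              exact hlast a (by omega) (by omega) (by omega)
            refine ⟨p', h3, ?_⟩
            rw [ht_erase_right hp, ht_erase_right hp, if_neg hpa, if_neg (by omega)]
            omega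
        · refine ⟨q, hq, ?_⟩
          rw [ht_erase_right hp, ht_erase_right hp, if_neg hpa, if_neg hqp]
          omega
  refine ⟨p', hmt, hp', herase, herase ▸ matched_mono A hF, fun x hx hxp => ?_⟩
  obtain ⟨hxA, q, hq, hle'⟩ := mem_matched.1 hx
  have hFP : F ⊆ P := hF.trans (Finset.erase_subset _ _)
  have hz : ∀ r, r < p → ht A F r = ht A P r := fun r hr => by
    rw [ht_sdiff hFP]
    have : (P \ F).filter (· ≤ r) = ∅ := by
      ext y
      simp only [Finset.mem_filter, Finset.mem_sdiff, Finset.notMem_empty, iff_false]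
      rintro ⟨⟨h1, h2⟩, h3⟩
      exact h2 (hlow y h1 (by omega))
    simp [this]
  by_cases hqp : q < p
  · exact mem_matched.2 ⟨hxA, q, hq, by rw [hz q hqp, hz x (by omega)]; exact hle'⟩
  · refine mem_matched.2 ⟨hxA, p', hxp, ?_⟩
    rw [hz p' hp', hz x (by omega)]
    have := hmin q (by omega)
    omega

theorem card_matched {A B : Finset ℕ} (h : Tab A B) : (matched A B).card = B.card := by
  induction hn : B.card generalizing B with
  | zero =>
    rw [Finset.card_eq_zero] at hn
    subst hn
    simp [matched_empty]
  | succ n ih =>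
    obtain ⟨p, hp⟩ : B.Nonempty := Finset.card_pos.1 (by omega)
    obtain ⟨p', hp', _, he, _⟩ := matched_erase (F := B.filter (· < p)) h hp
      (fun x hx => by
        rw [Finset.mem_filter] at hx
        exact Finset.mem_erase.2 ⟨hx.2.ne, hx.1⟩)
      (fun x hx hlt => by simp [hx, hlt])
    have h1 := ih (h.mono (Finset.erase_subset p B)) (by rw [Finset.card_erase_of_mem hp]; omega)
    rw [he, Finset.card_erase_of_mem hp'] at h1
    have : 0 < (matched A B).card := Finset.card_pos.2 ⟨p', hp'⟩
    omega

/-- Moving the letter `b` of the second column to the letter `b + t` of the first one. -/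
structure FMove (A B : Finset ℕ) (b t : ℕ) : Prop where
  mem_right : ∀ x, b ≤ x → x ≤ b + t → x ∈ B
  mem_left : ∀ x, b ≤ x → x < b + t → x ∈ A
  notMem : b + t ∉ A
  ge : ∀ q, -1 ≤ ht A B q
  nonneg : ∀ q, q < b → 0 ≤ ht A B q
  eq : ht A B b = -1

namespace FMove

variable {A B : Finset ℕ} {b t : ℕ}

theorem mem_b (h : FMove A B b t) : b ∈ B := h.mem_right b le_rfl (by omega)

theorem eq_neg_one (h : FMove A B b t) {x : ℕ} (h1 : b ≤ x) (h2 : x ≤ b + t) :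
    ht A B x = -1 := by
  induction x, h1 using Nat.le_induction with
  | base => exact h.eq
  | succ x hx ih =>
    rw [ht_succ, ih (by omega), if_pos (h.mem_left x hx (by omega)),
      if_pos (h.mem_right (x + 1) (by omega) h2)]
    omega

theorem ht_new (h : FMove A B b t) (q : ℕ) :
    ht (insert (b + t) A) (B.erase b) q =
      ht A B q + (if b ≤ q then 1 else 0) + (if b + t < q then 1 else 0) := by
  rw [ht_insert_left h.notMem, ht_erase_right h.mem_b]

theorem tab_new (h : FMove A B b t) : Tab (insert (b + t) A) (B.erase b) := fun q => by
  rw [h.ht_new]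
  have := h.ge q
  have := h.nonneg q
  split_ifs <;> omega

/-- The common part of the invariance of the matched letters under a move. -/
theorem matched_insert_aux (h : FMove A B b t) {I I' : Finset ℕ} (hI : I ⊆ B)
    (hcase : (b ∉ I ∧ I' = I) ∨ (b ∈ I ∧ I' = I.erase b ∧ ∀ x ∈ B, x < b → x ∈ I) ∨
      (b ∈ I ∧ ∃ g ∈ B, g ∉ I ∧ g < b ∧ (∀ x ∈ B, g < x → x < b → x ∈ I) ∧
        I' = insert g (I.erase b))) :
    matched (insert (b + t) A) I' = matched A I := by
  have hκ := fun q => ht_sdiff (A := A) hI q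
  set n : ℕ → ℤ := fun q => (((B \ I).filter (· ≤ q)).card : ℤ) with hn
  have hmono : ∀ p q, p ≤ q → n p ≤ n q := fun p q hpq => by
    simp only [hn, Nat.cast_le]
    exact card_filter_le_mono _ hpq
  have hn0 : ∀ q, 0 ≤ n q := fun q => by simp [hn]
  have hκ' : ∀ q, ht A I q = ht A B q + n q := hκ
  have hge : ∀ x q, b ≤ x → x ≤ b + t → x ≤ q → ht A I x ≤ ht A I q := fun x q h1 h2 h3 => by
    rw [hκ', hκ', h.eq_neg_one h1 h2]
    have := h.ge q
    have := hmono x q h3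
    omega
  rcases hcase with ⟨hb, rfl⟩ | ⟨hb, rfl, hlow⟩ | ⟨hb, g, hgB, hgI, hgb, hbet, rfl⟩
  · have hnew := fun q => ht_insert_left (B := I') h.notMem q
    ext x
    simp only [mem_matched, hnew, Finset.mem_insert]
    constructor
    · rintro ⟨rfl | hx, q, hq, hle⟩
      · have := hge (b + t) q (by omega) le_rfl hq.le
        simp only [lt_irrefl, if_false, if_pos hq] at hle
        omega
      · refine ⟨hx, q, hq, ?_⟩
        split_ifs at hle <;> omega
    · rintro ⟨hx, q, hq, hle⟩
      refine ⟨Or.inr hx, ?_⟩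
      by_cases hxa : x < b + t
      · by_cases hqa : b + t < q
        · refine ⟨b + t, hxa, ?_⟩
          have := hge (b + t) q (by omega) le_rfl hqa.le
          split_ifs <;> omega
        · refine ⟨q, hq, ?_⟩
          split_ifs <;> omega
      · refine ⟨q, hq, ?_⟩
        have : x ≠ b + t := by rintro rfl; exact h.notMem hx
        split_ifs <;> omega
  · have hnew := fun q => (ht_insert_left (B := I.erase b) h.notMem q).trans
      (by rw [ht_erase_right hb])
    have hnb : n b = 0 := by
      simp only [hn, Nat.cast_eq_zero, Finset.card_eq_zero]
      ext y
      simp only [Finset.mem_filter, Finset.mem_sdiff, Finset.notMem_empty, iff_false]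
      rintro ⟨⟨h1, h2⟩, h3⟩
      rcases h3.lt_or_eq with h3 | rfl
      · exact h2 (hlow y h1 h3)
      · exact h2 hb
    ext x
    simp only [mem_matched, hnew, Finset.mem_insert]
    constructor
    · rintro ⟨rfl | hx, q, hq, hle⟩
      · have := hge (b + t) q (by omega) le_rfl hq.le
        simp only [lt_irrefl, if_false, if_pos hq] at hle
        split_ifs at hle <;> omega
      · refine ⟨hx, q, hq, ?_⟩
        split_ifs at hle <;> omega
    · rintro ⟨hx, q, hq, hle⟩
      refine ⟨Or.inr hx, ?_⟩
      by_cases hxa : x < b + t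
      · by_cases hxb : b ≤ x
        · by_cases hqa : b + t < q
          · refine ⟨b + t, hxa, ?_⟩
            have := hge (b + t) q (by omega) le_rfl hqa.le
            split_ifs <;> omega
          · refine ⟨q, hq, ?_⟩
            split_ifs <;> omega
        · by_cases hqb : q < b
          · refine ⟨q, hq, ?_⟩
            split_ifs <;> omega
          · refine ⟨b, by omega, ?_⟩
            have h1 := h.nonneg x (by omega)
            have h2 := hκ' x
            have h3 := hκ' b
            have h4 := hn0 x
            have h5 := h.eq
            split_ifs <;> omega
      · refine ⟨q, hq, ?_⟩
        have : x ≠ b + t := by rintro rfl; exact h.notMem hx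
        split_ifs <;> omega
  · have hnew := fun q => (ht_insert_left (B := insert g (I.erase b)) h.notMem q).trans
      (by rw [ht_insert_right (by simp [hgI]), ht_erase_right hb])
    have hnb : ∀ x, g ≤ x → x ≤ b → n x = n b := by
      intro x h1 h2
      simp only [hn]
      congr 2
      ext y
      simp only [Finset.mem_filter, Finset.mem_sdiff]
      constructor
      · rintro ⟨⟨h3, h4⟩, h5⟩
        exact ⟨⟨h3, h4⟩, by omega⟩
      · rintro ⟨⟨h3, h4⟩, h5⟩
        refine ⟨⟨h3, h4⟩, ?_⟩
        by_contra h6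
        rcases h5.lt_or_eq with h5 | rfl
        · exact h4 (hbet y h3 (by omega) h5)
        · exact h4 hb
    have hgx : ∀ x, g ≤ x → x < b → ht A I b + 1 ≤ ht A I x := fun x h1 h2 => by
      rw [hκ', hκ', hnb x h1 h2.le, h.eq]
      have := h.nonneg x h2
      omega
    ext x
    simp only [mem_matched, hnew, Finset.mem_insert]
    constructor
    · rintro ⟨rfl | hx, q, hq, hle⟩
      · have := hge (b + t) q (by omega) le_rfl hq.le
        simp only [lt_irrefl, if_false, if_pos hq] at hle
        split_ifs at hle <;> omega
      · refine ⟨hx, ?_⟩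
        by_cases hxb : b ≤ x
        · refine ⟨q, hq, ?_⟩
          split_ifs at hle <;> omega
        · by_cases hgq : g ≤ x
          · exact ⟨b, by omega, by have := hgx x hgq (by omega); omega⟩
          · by_cases hq2 : g ≤ q ∧ q < b
            · refine ⟨b, by omega, ?_⟩
              have := hgx q hq2.1 hq2.2
              split_ifs at hle <;> omega
            · refine ⟨q, hq, ?_⟩
              split_ifs at hle <;> omega
    · rintro ⟨hx, q, hq, hle⟩
      refine ⟨Or.inr hx, ?_⟩
      by_cases hxa : x < b + t
      · by_cases hxb : b ≤ x
        · by_cases hqa : b + t < q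
          · refine ⟨b + t, hxa, ?_⟩
            have := hge (b + t) q (by omega) le_rfl hqa.le
            split_ifs <;> omega
          · refine ⟨q, hq, ?_⟩
            split_ifs <;> omega
        · by_cases hgq : g ≤ x
          · refine ⟨b, by omega, ?_⟩
            have := hgx x hgq (by omega)
            split_ifs <;> omega
          · by_cases hqb : q ≤ b
            · refine ⟨q, hq, ?_⟩
              split_ifs <;> omega
            · refine ⟨b, by omega, ?_⟩
              have := hge b q le_rfl (by omega) (by omega)
              split_ifs <;> omega
      · refine ⟨q, hq, ?_⟩
        have : x ≠ b + t := by rintro rfl; exact h.notMem hx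
        split_ifs <;> omega

theorem matched_new (h : FMove A B b t) : matched (insert (b + t) A) (B.erase b) = matched A B :=
  h.matched_insert_aux (Finset.Subset.refl _) (Or.inr (Or.inl ⟨h.mem_b, rfl, fun _ hx _ => hx⟩))

end FMove

theorem matched_erase_left {B D : Finset ℕ} {b : ℕ} (hb : b ∈ B) :
    (b ∉ matched B D ∧ matched (B.erase b) D = matched B D) ∨
    (b ∈ matched B D ∧ matched (B.erase b) D = (matched B D).erase b ∧
        ∀ x ∈ B, x < b → x ∈ matched B D) ∨
    (b ∈ matched B D ∧ ∃ g ∈ B, g ∉ matched B D ∧ g < b ∧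
        (∀ x ∈ B, g < x → x < b → x ∈ matched B D) ∧
      matched (B.erase b) D = insert g ((matched B D).erase b)) := by
  have hnew := fun q => ht_erase_left (B := D) hb q
  have hun : ∀ x ∈ B, x ∉ matched B D → ∀ q, x < q → ht B D x + 1 ≤ ht B D q := by
    intro x hx hxm q hq
    by_contra hc
    exact hxm (mem_matched.2 ⟨hx, q, hq, by omega⟩)
  have hsub : ∀ x ∈ matched B D, x ≠ b → x ∈ matched (B.erase b) D := by
    intro x hx hxb
    obtain ⟨hxB, q, hq, hle⟩ := mem_matched.1 hx
    refine mem_matched.2 ⟨Finset.mem_erase.2 ⟨hxb, hxB⟩, q, hq, ?_⟩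
    rw [hnew, hnew]
    split_ifs <;> omega
  have hgt : ∀ x ∈ matched (B.erase b) D, b < x → x ∈ matched B D := by
    intro x hx hbx
    obtain ⟨hxB, q, hq, hle⟩ := mem_matched.1 hx
    refine mem_matched.2 ⟨(Finset.mem_erase.1 hxB).2, q, hq, ?_⟩
    rw [hnew, hnew] at hle
    split_ifs at hle <;> omega
  have hne : ∀ x ∈ matched (B.erase b) D, x ≠ b ∧ x ∈ B := fun x hx =>
    Finset.mem_erase.1 (mem_matched.1 hx).1
  by_cases hbI : b ∈ matched B D
  · right
    by_cases hlow : ∀ x ∈ B, x < b → x ∈ matched B D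
    · left
      refine ⟨hbI, ?_, hlow⟩
      ext x
      rw [Finset.mem_erase]
      refine ⟨fun hx => ⟨(hne x hx).1, ?_⟩, fun hx => hsub x hx.2 hx.1⟩
      rcases lt_or_gt_of_ne (hne x hx).1 with hlt | hlt
      · exact hlow x (hne x hx).2 hlt
      · exact hgt x hx hlt
    · right
      push Not at hlow
      obtain ⟨x0, hx0B, hx0b, hx0⟩ := hlow
      obtain ⟨g, hgb, ⟨hgB, hgI⟩, hlast⟩ := exists_last_lt (P := fun x => x ∈ B ∧ x ∉ matched B D)
        ⟨x0, hx0b, hx0B, hx0⟩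
      have hbet : ∀ x ∈ B, g < x → x < b → x ∈ matched B D := fun x hx h1 h2 => by
        by_contra h3
        exact hlast x h1 h2 ⟨hx, h3⟩
      have hgu := hun g hgB hgI
      refine ⟨hbI, g, hgB, hgI, hgb, hbet, ?_⟩
      have hg1 : ht B D (g + 1) ≤ ht B D g + 1 := by
        rw [ht_succ, if_pos hgB]
        split_ifs <;> omega
      obtain ⟨q0, hq0b, ⟨hq0g, hq0⟩, hq0l⟩ := exists_last_lt
        (P := fun q => g < q ∧ ht B D q ≤ ht B D g + 1) (n := b + 1) ⟨g +
            1, by omega, by omega, hg1⟩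
      have hex : ∃ q, b < q ∧ ht B D q ≤ ht B D g + 1 := by
        have hq0m : q0 ∈ matched B D := by
          by_cases he : q0 = b
          · rwa [he]
          · have h1 := hq0l (q0 + 1) (by omega) (by omega)
            have h2 := ht_succ B D q0
            refine hbet q0 ?_ hq0g (by omega)
            by_contra h3
            rw [if_neg h3] at h2
            apply h1
            refine ⟨by omega, ?_⟩
            split_ifs at h2 <;> omega
        obtain ⟨_, q, hq, hle⟩ := mem_matched.1 hq0m
        refine ⟨q, ?_, by omega⟩
        by_contra h3
        exact hq0l q hq (by omega) ⟨by omega, by omega⟩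
      ext x
      rw [Finset.mem_insert, Finset.mem_erase]
      constructor
      · intro hx
        by_cases hxI : x ∈ matched B D
        · exact Or.inr ⟨(hne x hx).1, hxI⟩
        · left
          by_contra hxg
          have hxb : x < b := by
            rcases lt_or_gt_of_ne (hne x hx).1 with hlt | hlt
            · exact hlt
            · exact absurd (hgt x hx hlt) hxI
          have hlt : x < g := by
            by_contra h3
            exact hxI (hbet x (hne x hx).2 (by omega) hxb)
          have hxu := hun x (hne x hx).2 hxI
          obtain ⟨_, q, hq, hle⟩ := mem_matched.1 hx
          rw [hnew, hnew] at hle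
          have h1 := hxu q hq
          have h2 := hxu g hlt
          have h3 := hgu q
          split_ifs at hle <;> omega
      · rintro (rfl | ⟨h1, h2⟩)
        · obtain ⟨q, hq, hle⟩ := hex
          refine mem_matched.2 ⟨Finset.mem_erase.2 ⟨hgb.ne, hgB⟩, q, by omega, ?_⟩
          rw [hnew, hnew]
          split_ifs <;> omega
        · exact hsub x h2 h1
  · left
    refine ⟨hbI, ?_⟩
    ext x
    refine ⟨fun hx => ?_, fun hx => hsub x hx (by rintro rfl; exact hbI hx)⟩
    rcases lt_or_gt_of_ne (hne x hx).1 with hlt | hlt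
    · by_contra hxI
      have hxu := hun x (hne x hx).2 hxI
      have hbu := hun b hb hbI
      obtain ⟨_, q, hq, hle⟩ := mem_matched.1 hx
      rw [hnew, hnew] at hle
      have h1 := hxu q hq
      have h2 := hxu b hlt
      have h3 := hbu q
      split_ifs at hle <;> omega
    · exact hgt x hx hlt

theorem FMove.matched_matched_new {A B : Finset ℕ} {b t : ℕ} (h : FMove A B b t) (D : Finset ℕ) :
    matched (insert (b + t) A) (matched (B.erase b) D) = matched A (matched B D) :=
  h.matched_insert_aux (matched_subset B D) (matched_erase_left h.mem_b)

/-! ### Moving letters between two columns -/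

theorem card_filter_le_eq_zero {S : Finset ℕ} {q : ℕ} (h : ∀ x ∈ S, q < x) :
    (S.filter (· ≤ q)).card = 0 := by
  rw [Finset.card_eq_zero, Finset.filter_eq_empty_iff]
  intro x hx
  have := h x hx
  omega

theorem card_filter_lt_eq_zero {S : Finset ℕ} {q : ℕ} (h : ∀ x ∈ S, q ≤ x) :
    (S.filter (· < q)).card = 0 := by
  rw [Finset.card_eq_zero, Finset.filter_eq_empty_iff]
  intro x hx
  have := h x hx
  omega

theorem rowLT_iff_tab (X Y : List ℕ) (hX : X.Pairwise (· < ·)) (hY : Y.Pairwise (· < ·)) :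
    RowLT X Y ↔ Tab X.toFinset Y.toFinset := by
  induction X generalizing Y with
  | nil =>
    cases Y with
    | nil => simp [RowLT, tab_empty]
    | cons y Y =>
      simp only [RowLT, false_iff]
      intro h
      have := h y
      simp only [ht, List.toFinset_nil, Finset.filter_empty, Finset.card_empty] at this
      have h2 : 0 < ((y :: Y).toFinset.filter (· ≤ y)).card :=
        Finset.card_pos.2 ⟨y, by simp⟩
      omega
  | cons x X ih =>
    cases Y with
    | nil => simp [RowLT, tab_empty]
    | cons y Y =>
      obtain ⟨hx, hX⟩ := List.pairwise_cons.1 hX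
      obtain ⟨hy, hY⟩ := List.pairwise_cons.1 hY
      have hx0 : x ∉ X.toFinset := fun h => by
        have := hx x (by simpa using h); omega
      have hy0 : y ∉ Y.toFinset := fun h => by
        have := hy y (by simpa using h); omega
      have hht := fun q => (ht_insert_left (B := insert y Y.toFinset) hx0 q).trans
        (by rw [ht_insert_right hy0])
      simp only [RowLT, ih Y hX hY, List.toFinset_cons]
      constructor
      · rintro ⟨hxy, h⟩ q
        rw [hht]
        have := h q
        split_ifs <;> omega
      · intro h
        have hYc : ∀ q, q ≤ y → (Y.toFinset.filter (· ≤ q)).card = 0 := fun q hq =>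
          card_filter_le_eq_zero fun z hz => by
            have := hy z (by simpa using hz); omega
        have hxy : x < y := by
          by_contra hc
          have h1 := h y
          have h2 : (X.toFinset.filter (· < y)).card = 0 := card_filter_lt_eq_zero fun z hz => by
            have := hx z (by simpa using hz); omega
          rw [hht, if_neg hc, if_pos le_rfl, ht, h2, hYc y le_rfl] at h1
          omega
        refine ⟨hxy, fun q => ?_⟩
        by_cases hq : y ≤ q
        · have := h q
          rw [hht, if_pos hq, if_pos (by omega)] at this
          omega
        · rw [ht, hYc q (by omega)]
          simp

theorem rowLT_sort {A B : Finset ℕ} (h : Tab A B) : RowLT A.sort B.sort :=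
  (rowLT_iff_tab _ _ A.sortedLT_sort.pairwise B.sortedLT_sort.pairwise).2 (by simpa using h)

theorem desc_three {S : Finset ℕ} {M : List ℕ} (p q : ℕ) (hpq : p ≤ q + 1) (hM : M.Pairwise (· > ·))
    (hmem : ∀ x, x ∈ M ↔ x ∈ S ∧ p ≤ x ∧ x ≤ q) :
    desc S = desc (S.filter (q < ·)) ++ (M ++ desc (S.filter (· < p))) := by
  apply desc_eq
  · simp only [List.pairwise_append, List.mem_append, mem_desc, Finset.mem_filter]
    refine ⟨desc_pairwise _, ⟨hM, desc_pairwise _, ?_⟩, ?_⟩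
    · intro a ha b hb
      have := (hmem a).1 ha
      omega
    · rintro a ha b (hb | hb)
      · have := (hmem b).1 hb
        omega
      · omega
  · intro x
    simp only [List.mem_append, mem_desc, Finset.mem_filter, hmem]
    constructor
    · tauto
    · intro h
      rcases lt_or_ge q x with h1 | h1
      · tauto
      · rcases lt_or_ge x p with h2 | h2 <;> tauto

theorem card_filter_lt_split (S : Finset ℕ) {c q : ℕ} (h : c < q) :
    (S.filter (· < q)).card = (S.filter (· ≤ c)).card + ((S.filter (c < ·)).filter (· < q)).card :=
        by
  rw [← Finset.card_filter_add_card_filter_not (s := S.filter (· < q)) (· ≤ c)]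
  simp only [Finset.filter_filter]
  congr 2 <;> ext x <;> simp only [Finset.mem_filter] <;> grind

theorem card_filter_le_split (S : Finset ℕ) {c q : ℕ} (h : c ≤ q) :
    (S.filter (· ≤ q)).card = (S.filter (· ≤ c)).card + ((S.filter (c < ·)).filter (· ≤ q)).card :=
        by
  rw [← Finset.card_filter_add_card_filter_not (s := S.filter (· ≤ q)) (· ≤ c)]
  simp only [Finset.filter_filter]
  congr 2 <;> ext x <;> simp only [Finset.mem_filter] <;> grind

theorem card_filter_le_eq_lt {S : Finset ℕ} {c : ℕ} (h : c ∉ S) :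
    (S.filter (· ≤ c)).card = (S.filter (· < c)).card := by
  congr 1
  ext x
  simp only [Finset.mem_filter]
  grind

theorem card_filter_le_eq_lt_add_one {S : Finset ℕ} {c : ℕ} (h : c ∈ S) :
    (S.filter (· ≤ c)).card = (S.filter (· < c)).card + 1 := by
  rw [show S.filter (· ≤ c) = insert c (S.filter (· < c)) by
    ext x
    simp only [Finset.mem_filter, Finset.mem_insert]
    grind]
  rw [Finset.card_insert_of_notMem (by simp)]

namespace FMove

variable {A B : Finset ℕ} {b t : ℕ}

theorem card_low (h : FMove A B b t) : (A.filter (· < b)).card = (B.filter (· < b)).card := by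
  have h1 := h.eq
  have h2 := card_filter_le_eq_lt_add_one h.mem_b
  simp only [ht] at h1
  omega

theorem tab_low (h : FMove A B b t) : Tab (A.filter (· < b)) (B.filter (· < b)) := by
  intro q
  by_cases hq : q < b
  · have h1 := h.nonneg q hq
    simp only [ht, Finset.filter_filter] at h1 ⊢
    convert h1 using 3
    · congr 1
      ext x
      simp only [Finset.mem_filter]
      grind
    · congr 1
      ext x
      simp only [Finset.mem_filter]
      grind
  · have h1 := h.card_low
    have e1 : (A.filter (· < b)).filter (· < q) = A.filter (· < b) := by
      ext x
      simp only [Finset.mem_filter]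
      grind
    have e2 : (B.filter (· < b)).filter (· ≤ q) = B.filter (· < b) := by
      ext x
      simp only [Finset.mem_filter]
      grind
    rw [ht, e1, e2]
    omega

theorem tab_high (h : FMove A B b t) :
    Tab (A.filter (b + t < ·)) (B.filter (b + t < ·)) := by
  intro q
  by_cases hq : b + t < q
  · have h1 := h.ge q
    have h2 := h.eq_neg_one (x := b + t) (by omega) le_rfl
    have h3 := card_filter_lt_split A hq
    have h4 := card_filter_le_split B hq.le
    have h5 := card_filter_le_eq_lt h.notMem
    simp only [ht] at h1 h2 ⊢
    omega
  · rw [ht, card_filter_le_eq_zero (S := B.filter (b + t < ·))]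
    · simp
    · intro x hx
      simp only [Finset.mem_filter] at hx
      omega

theorem ck (h : FMove A B b t) :
    CKEquiv (desc A ++ desc B) (desc (insert (b + t) A) ++ desc (B.erase b)) := by
  obtain ⟨R, R', hR, hR', hmR, hmR', hins⟩ : ∃ R R' : List ℕ, R.Pairwise (· > ·) ∧
      R'.Pairwise (· > ·) ∧ (∀ x, x ∈ R ↔ b ≤ x ∧ x < b + t) ∧
      (∀ x, x ∈ R' ↔ b < x ∧ x ≤ b + t) ∧
      ∀ H L : List ℕ, (H ++ runD b t ++ L).Pairwise (· > ·) →
        CKEquiv (R ++ (H ++ (runD b t ++ L))) (H ++ (runD b t ++ (L ++ R'))) := by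
    cases t with
    | zero =>
      refine ⟨[], [], by simp, by simp, fun x => ?_, fun x => ?_, fun H L _ => ?_⟩
      · simp
      · simp
      · simpa using CKEquiv.refl _
    | succ t =>
      refine ⟨runD b t, runD (b + 1) t, runD_pairwise _ _, runD_pairwise _ _, fun x => ?_,
        fun x => ?_, fun H L hHL => ck_insert_run b t H L hHL⟩
      · rw [mem_runD]; omega
      · rw [mem_runD]; omega
  set A1 := A.filter (· < b) with hA1
  set A2 := A.filter (b + t < ·) with hA2
  set B1 := B.filter (· < b) with hB1
  set B2 := B.filter (b + t < ·) with hB2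
  have d1 : desc A = desc A2 ++ (R ++ desc A1) := by
    apply desc_three b (b + t) (by omega) hR
    intro x
    rw [hmR]
    have := h.mem_left x
    have := h.notMem
    grind
  have d2 : desc B = desc B2 ++ (runD b t ++ desc B1) := by
    apply desc_three b (b + t) (by omega) (runD_pairwise _ _)
    intro x
    rw [mem_runD]
    have := h.mem_right x
    grind
  have d3 : desc (insert (b + t) A) = desc A2 ++ (runD b t ++ desc A1) := by
    rw [desc_three b (b + t) (by omega) (runD_pairwise b t)]
    · have e2 : (insert (b + t) A).filter (b + t < ·) = A2 := by
        ext x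
        simp only [hA2, Finset.mem_filter, Finset.mem_insert]
        clear hins d1 d2
        grind
      have e1 : (insert (b + t) A).filter (· < b) = A1 := by
        ext x
        simp only [hA1, Finset.mem_filter, Finset.mem_insert]
        clear hins d1 d2
        grind
      rw [e1, e2]
    · intro x
      rw [mem_runD, Finset.mem_insert]
      have := h.mem_left x
      clear hins d1 d2
      grind
  have d4 : desc (B.erase b) = desc B2 ++ (R' ++ desc B1) := by
    rw [desc_three b (b + t) (by omega) hR']
    · have e2 : (B.erase b).filter (b + t < ·) = B2 := by
        ext x
        simp only [hB2, Finset.mem_filter, Finset.mem_erase]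
        clear hins d1 d2 d3
        grind
      have e1 : (B.erase b).filter (· < b) = B1 := by
        ext x
        simp only [hB1, Finset.mem_filter, Finset.mem_erase]
        clear hins d1 d2 d3
        grind
      rw [e1, e2]
    · intro x
      rw [hmR', Finset.mem_erase]
      have := h.mem_right x
      clear hins d1 d2 d3
      grind
  have hp2 := desc_pairwise B
  have hp3 := desc_pairwise (insert (b + t) A)
  have s1 : CKEquiv (desc A1 ++ (desc B2 ++ (runD b t ++ desc B1)))
      (desc B2 ++ (runD b t ++ (desc A1 ++ desc B1))) := by
    have := ck_insert_column A1.sort B1.sort (desc B2 ++ runD b t) [] (rowLT_sort h.tab_low)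
      A1.sortedLT_sort.pairwise ?_ (by simp) (by simp) ?_
    · simpa [desc] using this
    · rw [d2, ← List.append_assoc] at hp2
      exact hp2
    · left
      simpa using h.card_low
  have s2 : CKEquiv (R ++ (desc B2 ++ (runD b t ++ desc A1)))
      (desc B2 ++ (runD b t ++ (desc A1 ++ R'))) := by
    apply hins
    simp only [List.pairwise_append, List.mem_append, mem_desc, mem_runD, hA1, hB2,
      Finset.mem_filter]
    refine ⟨⟨desc_pairwise _, runD_pairwise _ _, ?_⟩, desc_pairwise _, ?_⟩
    · intros; omega
    · rintro x (hx | hx) y hy <;> omega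
  have s3 : CKEquiv (desc A2 ++ (desc B2 ++ (runD b t ++ desc A1)))
      (desc A2 ++ (runD b t ++ (desc A1 ++ desc B2))) := by
    have := ck_insert_column A2.sort B2.sort [] (runD b t ++ desc A1) (rowLT_sort h.tab_high)
      A2.sortedLT_sort.pairwise ?_ ?_ ?_ (Or.inr rfl)
    · simpa [desc] using this
    · simpa [desc] using desc_pairwise B2
    · rw [d3] at hp3
      exact hp3.sublist (List.sublist_append_right _ _)
    · intro z hz x hx
      simp only [List.mem_append, mem_desc, mem_runD, hA1, hA2, Finset.mem_filter,
        Finset.mem_sort] at hz hx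
      omega
  rw [d1, d2, d3, d4]
  have t1 := s1.left (desc A2 ++ R)
  have t2 := (s2.right (desc B1)).left (desc A2)
  have t3 := s3.right (R' ++ desc B1)
  simp only [List.append_assoc] at *
  exact t1.trans (t2.trans t3)

end FMove

theorem not_reduced_columns {A B : Finset ℕ} {p n : ℕ} (hA : ∀ x, p ≤ x → x ≤ p + n → x ∈ A)
    (hB : ∀ x, p ≤ x → x ≤ p + n → x ∈ B) (hpA : ∀ x ∈ A, x + 1 ≠ p) (hpB : p + n + 1 ∉ B) :
    ¬ IsReducedWord (desc A ++ desc B) := by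
  intro h
  rw [desc_three (S := A) p (p + n) (by omega) (runD_pairwise p n)
      (fun x => by rw [mem_runD]; have := hA x; grind),
    desc_three (S := B) p (p + n) (by omega) (runD_pairwise p n)
      (fun x => by rw [mem_runD]; have := hB x; grind)] at h
  refine not_reduced_runD (p := p) (n := n) (A := desc (A.filter (· < p)))
    (B := desc (B.filter (p + n < ·))) ?_ ?_ (IsReducedWord.of_infix (a := desc (A.filter (p +
        n < ·)))
      (b := desc (B.filter (· < p))) (by simpa using h))
  · intro x hx
    rw [mem_desc, Finset.mem_filter] at hx
    have := hpA x hx.1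
    omega
  · intro x hx
    rw [mem_desc, Finset.mem_filter] at hx
    have : x ≠ p + n + 1 := by rintro rfl; exact hpB hx.1
    omega

theorem exists_fMove_of_insert {A B : Finset ℕ} {x : ℕ} (hr : IsReducedWord (desc A ++ desc B))
    (hx : x ∈ B) (hT : Tab A (B.erase x)) (hn : ¬ Tab A B) : ∃ b t, x ≤ b ∧ FMove A B b t := by
  classical
  have hht := fun q => ht_erase_right (A := A) hx q
  have hge : ∀ q, -1 ≤ ht A B q := fun q => by
    have := hT q
    rw [hht] at this
    split_ifs at this <;> omega
  have hex : ∃ q, ht A B q < 0 := by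
    simpa [Tab] using hn
  obtain ⟨b, hb, hfirst⟩ : ∃ b, ht A B b < 0 ∧ ∀ q < b, 0 ≤ ht A B q :=
    ⟨Nat.find hex, Nat.find_spec hex, fun q hq => not_lt.1 (Nat.find_min hex hq)⟩
  have hbx : x ≤ b := by
    have := hT b
    rw [hht] at this
    split_ifs at this <;> omega
  have hx1 : 1 ≤ x := hr.1 x (by simp [mem_desc, hx])
  obtain ⟨c, rfl⟩ : ∃ c, b = c + 1 := ⟨b - 1, by omega⟩
  have hstep := ht_succ A B c
  have hc := hfirst c (by omega)
  have hbB : c + 1 ∈ B := by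
    by_contra h
    rw [if_neg h] at hstep
    split_ifs at hstep <;> omega
  have hcA : c ∉ A := by
    intro h
    rw [if_pos h] at hstep
    split_ifs at hstep; omega
  have hext : ∃ t, c + 1 + t ∉ A := by
    refine ⟨A.sup id, fun h => ?_⟩
    have : c + 1 + A.sup id ≤ A.sup id := Finset.le_sup (f := id) h
    omega
  obtain ⟨t, ht1, ht2⟩ : ∃ t, c + 1 + t ∉ A ∧ ∀ s < t, c + 1 + s ∈ A :=
    ⟨Nat.find hext, Nat.find_spec hext, fun s hs => not_not.1 (Nat.find_min hext hs)⟩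
  have hl : ∀ y, c + 1 ≤ y → y < c + 1 + t → y ∈ A := fun y h1 h2 => by
    have := ht2 (y - (c + 1)) (by omega)
    rwa [show c + 1 + (y - (c + 1)) = y by omega] at this
  refine ⟨c + 1, t, hbx, ?_, hl, ht1, hge, hfirst, by have := hge (c + 1); omega⟩
  have : ∀ s, s ≤ t → ∀ y, c + 1 ≤ y → y ≤ c + 1 + s → y ∈ B := by
    intro s
    induction s with
    | zero =>
      intro _ y h1 h2
      rwa [show y = c + 1 by omega]
    | succ s ih =>
      intro hs y h1 h2
      by_cases hy : y = c + 1 + s + 1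
      · by_contra hyB
        refine not_reduced_columns (p := c + 1) (n := s) (fun z h3 h4 => hl z h3 (by omega))
          (ih (by omega)) ?_ (hy ▸ hyB) hr
        intro z hz h
        exact hcA (by rwa [show c = z by omega])
      · exact ih (by omega) y h1 (by omega)
  exact this t le_rfl

theorem exists_last_zero {A B : Finset ℕ} (hT : Tab A B) (hc : B.card < A.card) :
    ∃ a ∈ A, ht A B a = 0 ∧ ∀ q, a < q → 0 < ht A B q := by
  set N := (A ∪ B).sup id + 1 with hN
  have hlarge : ∀ q, N ≤ q → 0 < ht A B q := by
    intro q hq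
    have hmem : ∀ x ∈ A ∪ B, x < q := fun x hx => by
      have := Finset.le_sup (f := id) hx
      simp only [id] at this
      omega
    have e1 : A.filter (· < q) = A := Finset.filter_true_of_mem fun x hx => hmem x (by simp [hx])
    have e2 : B.filter (· ≤ q) = B :=
      Finset.filter_true_of_mem fun x hx => (hmem x (by simp [hx])).le
    rw [ht, e1, e2]
    omega
  obtain ⟨a, haN, ha0, hlast⟩ := exists_last_lt (P := fun q => ht A B q = 0) (n := N)
    ⟨0, by omega, le_antisymm (ht_zero_nonpos A B) (hT 0)⟩
  have hpos : ∀ q, a < q → 0 < ht A B q := fun q hq => by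
    by_cases h : q < N
    · have := hT q
      have := hlast q hq h
      omega
    · exact hlarge q (by omega)
  refine ⟨a, ?_, ha0, hpos⟩
  by_contra h
  have h1 := ht_succ A B a
  have h2 := hpos (a + 1) (by omega)
  rw [if_neg h] at h1
  split_ifs at h1 <;> omega

theorem exists_fMove_of_erase {A B : Finset ℕ} {a : ℕ} (hr : IsReducedWord (desc A ++ desc B))
    (hT : Tab A B) (ha : a ∈ A) (h0 : ht A B a = 0) (hpos : ∀ q, a < q → 0 < ht A B q) :
    ∃ b t, b + t = a ∧ b ∉ B ∧ FMove (A.erase a) (insert b B) b t := by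
  classical
  have hext : ∃ s, a - s ∉ B := ⟨a, fun h => by
    have := hr.1 (a - a) (by rw [List.mem_append, mem_desc, mem_desc]; exact Or.inr h)
    omega⟩
  obtain ⟨s, hs1, hs2⟩ : ∃ s, a - s ∉ B ∧ ∀ r < s, a - r ∈ B :=
    ⟨Nat.find hext, Nat.find_spec hext, fun r hr => not_not.1 (Nat.find_min hext hr)⟩
  have hB0 : ∀ y ∈ B, 1 ≤ y := fun y hy => hr.1 y (by simp [mem_desc, hy])
  have hsa : s ≤ a := by
    by_contra h
    have := hB0 _ (hs2 a (by omega))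
    omega
  have hB : ∀ y, a - s < y → y ≤ a → y ∈ B := fun y h1 h2 => by
    have := hs2 (a - y) (by omega)
    rwa [show a - (a - y) = y by omega] at this
  have haB : a + 1 ∉ B := fun h => by
    have h1 := ht_succ A B a
    have h2 := hpos (a + 1) (by omega)
    rw [if_pos ha, if_pos h] at h1
    omega
  have hA : ∀ r, r ≤ s → ∀ y, a - r ≤ y → y ≤ a → y ∈ A := by
    intro r
    induction r with
    | zero =>
      intro _ y h1 h2
      rwa [show y = a by omega]
    | succ r ih =>
      intro hrs y h1 h2
      by_cases hy : y = a - (r + 1)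
      · by_contra hyA
        refine not_reduced_columns (p := a - r) (n := r)
            (fun z h3 h4 => ih (by omega) z h3 (by omega))
          (fun z h3 h4 => hB z (by omega) (by omega)) ?_ ?_ hr
        · intro z hz h
          exact hyA (by rwa [show y = z by omega])
        · rwa [show a - r + r + 1 = a + 1 by omega]
      · exact ih (by omega) y (by omega) h2
  have hconst : ∀ r, r ≤ s → ht A B (a - r) = 0 := by
    intro r
    induction r with
    | zero => intro _; exact h0
    | succ r ih =>
      intro hrs
      have h1 := ht_succ A B (a - (r + 1))
      rw [if_pos (hA s le_rfl _ (by omega) (by omega)), if_pos (hB _ (by omega) (by omega)),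
        show a - (r + 1) + 1 = a - r by omega, ih (by omega)] at h1
      omega
  have hht := fun q => (ht_erase_left (B := insert (a - s) B) ha q).trans
    (by rw [ht_insert_right hs1])
  refine ⟨a - s, s, by omega, hs1, ?_, ?_, ?_, ?_, ?_, ?_⟩
  · intro x h1 h2
    by_cases hx : x = a - s
    · simp [hx]
    · exact Finset.mem_insert_of_mem (hB x (by omega) (by omega))
  · intro x h1 h2
    exact Finset.mem_erase.2 ⟨by omega, hA s le_rfl x (by omega) (by omega)⟩
  · rw [show a - s + s = a by omega]
    simp
  · intro q
    rw [hht]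
    have := hT q
    have := hpos q
    split_ifs <;> omega
  · intro q hq
    rw [hht]
    have := hT q
    split_ifs <;> omega
  · rw [hht, hconst s le_rfl]
    split_ifs <;> omega

/-! ### Tableaux as lists of columns -/

/-- The column reading word of a list of columns. -/
def colWord : List (Finset ℕ) → List ℕ
  | [] => []
  | A :: L => desc A ++ colWord L

/-- Consecutive columns form a tableau. -/
def TabChain : List (Finset ℕ) → Prop
  | [] => True
  | A :: L => Tab A (L.headD ∅) ∧ TabChain L

/-- The left key column: match column `c` with the columns to its left, one after the other. -/
noncomputable def chain : List (Finset ℕ) → ℕ → Finset ℕ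
  | [], _ => ∅
  | A :: _, 0 => A
  | A :: L, c + 1 => matched A (chain L c)

theorem chain_zero (L : List (Finset ℕ)) : chain L 0 = L.headD ∅ := by
  cases L <;> simp [chain]

theorem chain_subset_head (L : List (Finset ℕ)) (c : ℕ) : chain L c ⊆ L.headD ∅ := by
  cases L with
  | nil => simp [chain]
  | cons A L =>
    cases c with
    | zero => simp [chain]
    | succ c => exact matched_subset _ _

theorem chain_succ_subset (L : List (Finset ℕ)) (c : ℕ) : chain L (c + 1) ⊆ chain L c := by
  induction L generalizing c with
  | nil => simp [chain]
  | cons A L ih =>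
    cases c with
    | zero => exact matched_subset _ _
    | succ c => exact matched_mono _ (ih c)

theorem Tab.chain {A : Finset ℕ} {L : List (Finset ℕ)} (h : Tab A (L.headD ∅)) (c : ℕ) :
    Tab A (chain L c) := h.mono (chain_subset_head L c)

theorem card_chain {L : List (Finset ℕ)} (h : TabChain L) (c : ℕ) :
    (chain L c).card = (L.getD c ∅).card := by
  induction L generalizing c with
  | nil => simp [chain]
  | cons A L ih =>
    cases c with
    | zero => simp [chain]
    | succ c => simpa [_root_.chain, card_matched (h.1.chain c)] using ih h.2 c

theorem FMove.chain_eq {A B : Finset ℕ} {b t : ℕ} (h : FMove A B b t) (L : List (Finset ℕ))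
    (c : ℕ) : _root_.chain (insert (b + t) A :: B.erase b :: L) (c + 1) =
      _root_.chain (A :: B :: L) (c + 1) := by
  cases c with
  | zero => exact h.matched_new
  | succ c => exact h.matched_matched_new _

theorem Tab.card_le {A B : Finset ℕ} (h : Tab A B) : B.card ≤ A.card := by
  rw [← card_matched h]
  exact Finset.card_le_card (matched_subset _ _)

theorem Tab.insert_left {A B : Finset ℕ} (h : Tab A B) (a : ℕ) : Tab (insert a A) B := by
  by_cases ha : a ∈ A
  · rwa [Finset.insert_eq_of_mem ha]
  · intro q
    have := h q
    rw [ht_insert_left ha]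
    split_ifs <;> omega

theorem exists_head_le {L : List (Finset ℕ)} (h : TabChain L) {x : ℕ} (hx : x ∈ colWord L) :
    ∃ a ∈ L.headD ∅, a ≤ x := by
  induction L with
  | nil => simp [colWord] at hx
  | cons A L ih =>
    rw [colWord, List.mem_append, mem_desc] at hx
    rcases hx with hx | hx
    · exact ⟨x, hx, le_rfl⟩
    · obtain ⟨b, hb, hbx⟩ := ih h.2 hx
      have := h.1 b
      have h2 : 0 < ((L.headD ∅).filter (· ≤ b)).card :=
        Finset.card_pos.2 ⟨b, by simp only [Finset.mem_filter, le_refl, and_true]; exact hb⟩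
      have h1 : 0 < (A.filter (· < b)).card := by
        rw [ht] at this
        omega
      obtain ⟨a, ha⟩ := Finset.card_pos.1 h1
      rw [Finset.mem_filter] at ha
      exact ⟨a, ha.1, by omega⟩

/-! ### Inserting a letter on the right -/

theorem exists_insert (x : ℕ) (L : List (Finset ℕ)) (hL : TabChain L)
    (hr : IsReducedWord (colWord L ++ [x])) :
    ∃ B M, CKEquiv (colWord L ++ [x]) (colWord (B :: M)) ∧ TabChain (B :: M) ∧
      (∀ c, chain L c ⊆ chain (B :: M) c) ∧
      (B = L.headD ∅ ∨ ∃ y, y ∉ L.headD ∅ ∧ B = insert y (L.headD ∅) ∧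
        ∀ b ∈ B, y ≤ b → Tab (B.erase b) (M.headD ∅)) := by
  induction L with
  | nil =>
    refine ⟨{x}, [], .of_eq ?_, ⟨tab_empty _, trivial⟩, fun c => by simp [chain], Or.inr
      ⟨x, by simp, by simp, fun b _ _ => tab_empty _⟩⟩
    simp only [colWord, List.nil_append, List.append_nil]
    rw [desc_eq (l := [x])] <;> simp
  | cons A L ih =>
    obtain ⟨B, M, hck, hBM, hch, hB⟩ := ih hL.2 (by
      rw [colWord, List.append_assoc] at hr
      exact hr.of_append_right)
    have hck1 : CKEquiv (colWord (A :: L) ++ [x]) (colWord (A :: B :: M)) := by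
      rw [colWord, colWord, List.append_assoc]
      exact hck.left _
    have hch1 : ∀ c, chain (A :: L) c ⊆ chain (A :: B :: M) c := by
      rintro (_ | c)
      · exact subset_rfl
      · exact matched_mono _ (hch c)
    by_cases hT : Tab A B
    · exact ⟨A, B :: M, hck1, ⟨hT, hBM⟩, hch1, Or.inl rfl⟩
    · rcases hB with rfl | ⟨y, hy, hBy, hrem⟩
      · exact absurd hL.1 hT
      · have hr1 : IsReducedWord (desc A ++ desc B) := by
          have := hr.of_ck hck1
          rw [colWord, colWord, ← List.append_assoc] at this
          exact this.of_append_left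
        obtain ⟨b, t, hyb, hF⟩ := exists_fMove_of_insert (x := y) hr1 (by simp [hBy])
          (by rw [hBy, Finset.erase_insert hy]; exact hL.1) hT
        refine ⟨insert (b + t) A, B.erase b :: M, hck1.trans ?_,
          ⟨hF.tab_new, hrem b hF.mem_b hyb, hBM.2⟩, ?_, Or.inr ⟨b + t, hF.notMem, rfl, ?_⟩⟩
        · simpa [colWord] using hF.ck.right (colWord M)
        · rintro (_ | c)
          · exact Finset.subset_insert _ _
          · rw [hF.chain_eq]
            exact hch1 (c + 1)
        · intro q hq hle r
          have h1 := hF.ge r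
          have h2 := hF.tab_new r
          have h3 := hF.ht_new r
          simp only [List.headD_cons]
          rw [ht_erase_left hq]
          split_ifs at h3 ⊢ <;> omega

/-- Every reduced word is equivalent to the reading word of a tableau. -/
theorem exists_insert_word {L : List (Finset ℕ)} (hL : TabChain L) (w : List ℕ)
    (hr : IsReducedWord (colWord L ++ w)) :
    ∃ L', CKEquiv (colWord L ++ w) (colWord L') ∧ TabChain L' ∧
      ∀ c, chain L c ⊆ chain L' c := by
  induction w generalizing L with
  | nil => exact ⟨L, .of_eq (by simp), hL, fun c => subset_rfl⟩
  | cons x w ih =>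
    have e : colWord L ++ x :: w = colWord L ++ [x] ++ w := by simp
    rw [e] at hr ⊢
    obtain ⟨B, M, hck, hBM, hch, -⟩ := exists_insert x L hL hr.of_append_left
    obtain ⟨L', hck', hL', hch'⟩ := ih hBM (hr.of_ck (hck.right w))
    exact ⟨L', (hck.right w).trans hck', hL', fun c => (hch c).trans (hch' c)⟩

/-! ### Extracting a letter on the right -/

theorem exists_extract (A : Finset ℕ) (L : List (Finset ℕ)) (hL : TabChain (A :: L))
    (hc : (L.headD ∅).card < A.card) (hr : IsReducedWord (colWord (A :: L))) :
    ∃ a ∈ A, ∃ L' x, ht A (L.headD ∅) a = 0 ∧ (∀ q, a < q → 0 < ht A (L.headD ∅) q) ∧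
      TabChain (A.erase a :: L') ∧ CKEquiv (colWord (A :: L))
          (colWord (A.erase a :: L') ++ [x]) := by
  obtain ⟨a, ha, h0, hpos⟩ := exists_last_zero hL.1 hc
  induction L generalizing A a with
  | nil =>
    refine ⟨a, ha, [], a, h0, hpos, ⟨tab_empty _, trivial⟩, .of_eq ?_⟩
    simp only [colWord, List.append_nil]
    have hd : desc {a} = [a] := desc_eq (by simp) (by simp)
    rw [← hd]
    apply desc_union
    · intro x
      simp only [Finset.mem_erase, Finset.mem_singleton]
      grind
    · intro x hx y hy
      rw [Finset.mem_singleton] at hy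
      subst hy
      rw [Finset.mem_erase] at hx
      by_contra hlt
      have : 0 < (A.filter (· < y)).card :=
        Finset.card_pos.2 ⟨x, by rw [Finset.mem_filter]; exact ⟨hx.2, by omega⟩⟩
      simp only [ht, List.headD_nil, Finset.filter_empty, Finset.card_empty] at h0
      omega
  | cons B L ih =>
    simp only [List.headD_cons] at *
    have hr1 : IsReducedWord (desc A ++ desc B) := by
      rw [colWord, colWord, ← List.append_assoc] at hr
      exact hr.of_append_left
    obtain ⟨b, t, rfl, hb, hF⟩ := exists_fMove_of_erase hr1 hL.1 ha h0 hpos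
    have hck1 := hF.ck
    rw [Finset.insert_erase ha, Finset.erase_insert hb] at hck1
    have hck2 : CKEquiv (colWord (A :: B :: L))
        (desc (A.erase (b + t)) ++ colWord (insert b B :: L)) := by
      simpa [colWord] using (hck1.symm.right (colWord L))
    have hT2 : TabChain (insert b B :: L) := ⟨hL.2.1.insert_left b, hL.2.2⟩
    have hc2 : (L.headD ∅).card < (insert b B).card := by
      rw [Finset.card_insert_of_notMem hb]
      have := hL.2.1.card_le
      omega
    obtain ⟨a2, ha2, h02, hpos2⟩ := exists_last_zero hT2.1 hc2
    obtain ⟨a', ha', L', x, h0', hpos', hT', hck'⟩ :=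
      ih (insert b B) hT2 hc2 (hr.of_ck hck2).of_append_right a2 ha2 h02 hpos2
    have hab : a' ≤ b := by
      by_contra hlt
      have h1 := ht_insert_left (B := L.headD ∅) hb a'
      have h2 := hL.2.1 a'
      rw [if_pos (by omega)] at h1
      omega
    refine ⟨b + t, ha, (insert b B).erase a' :: L', x, h0, hpos, ⟨fun q => ?_, hT'⟩, ?_⟩
    · simp only [List.headD_cons]
      rw [ht_erase_right ha']
      have h1 := hF.ge q
      have h2 := hF.nonneg q
      split_ifs <;> omega
    · refine hck2.trans ?_
      have := hck'.left (desc (A.erase (b + t)))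
      simpa only [colWord, List.append_assoc] using this

theorem exists_extract_at (T : List (Finset ℕ)) (c : ℕ) (hT : TabChain T)
    (hr : IsReducedWord (colWord T)) (hc : (T.getD (c + 1) ∅).card < (T.getD c ∅).card) :
    ∃ T' x p, TabChain T' ∧ CKEquiv (colWord T) (colWord T' ++ [x]) ∧
      T'.headD ∅ ⊆ T.headD ∅ ∧ p ∈ chain T c ∧ chain T' c = (chain T c).erase p ∧
      chain T (c + 1) ⊆ (chain T c).erase p ∧
      ∀ y ∈ chain T c, y < p → y ∈ chain T (c + 1) := by
  induction c generalizing T with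
  | zero =>
    cases T with
    | nil => simp at hc
    | cons A L =>
      have hc' : (L.headD ∅).card < A.card := by
        cases L <;> simpa using hc
      obtain ⟨a, ha, L', x, h0, hpos, hT', hck⟩ := exists_extract A L hT hc' hr
      refine ⟨A.erase a :: L', x, a, hT', hck, Finset.erase_subset _ _, ha, rfl, ?_, ?_⟩
      · simp only [chain, chain_zero]
        intro y hy
        rw [mem_matched] at hy
        obtain ⟨hyA, q, hyq, hq⟩ := hy
        rw [Finset.mem_erase]
        refine ⟨?_, hyA⟩
        rintro rfl
        have := hpos q hyq
        omega
      · simp only [chain, chain_zero]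
        intro y hy hya
        rw [mem_matched]
        refine ⟨hy, a, hya, ?_⟩
        have := hT.1 y
        omega
  | succ c ih =>
    cases T with
    | nil => simp at hc
    | cons A L =>
      obtain ⟨L', x, p, hL', hck, hhead, hp, heq, hsub, hlow⟩ := ih L hT.2
        (by rw [colWord] at hr; exact hr.of_append_right) (by simpa using hc)
      obtain ⟨p', hp', -, h1, h2, h3⟩ := matched_erase (hT.1.chain c) hp hsub hlow
      refine ⟨A :: L', x, p', ⟨hT.1.mono hhead, hL'⟩, ?_, subset_rfl, hp', ?_, h2, h3⟩
      · rw [colWord, colWord, List.append_assoc]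
        exact hck.left _
      · simp only [chain, heq]
        exact h1

/-- If the smallest letter does not occur in column `c` of the key, an equivalent word has all
its occurrences among the last `c` letters. -/
theorem exists_free_prefix (m c : ℕ) (T : List (Finset ℕ)) (hT : TabChain T)
    (hr : IsReducedWord (colWord T)) (hm : ∀ x ∈ colWord T, m ≤ x) (hc : m ∉ chain T c) :
    ∃ u y, CKEquiv (colWord T) (u ++ y) ∧ m ∉ u ∧ y.length ≤ c := by
  induction c generalizing T with
  | zero =>
    refine ⟨colWord T, [], .of_eq (by simp), fun hmem => ?_, by simp⟩
    obtain ⟨a, ha, ham⟩ := exists_head_le hT hmem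
    rw [chain_zero] at hc
    have : m ≤ a := hm a (by
      cases T with
      | nil => simp at ha
      | cons A L => simp only [List.headD_cons] at ha; simp [colWord, mem_desc, ha])
    exact hc (by rwa [show m = a by omega])
  | succ c ih =>
    by_cases hmc : m ∈ chain T c
    · have hlt : (chain T (c + 1)).card < (chain T c).card :=
        Finset.card_lt_card ((Finset.ssubset_iff_of_subset (chain_succ_subset T c)).2
          ⟨m, hmc, hc⟩)
      rw [card_chain hT, card_chain hT] at hlt
      obtain ⟨T', x, p, hT', hck, -, hp, heq, hsub, hlow⟩ := exists_extract_at T c hT hr hlt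
      have hr' := hr.of_ck hck
      have hm' : ∀ y ∈ colWord T', m ≤ y := fun y hy =>
        hm y ((hck.mem_iff y).2 (by simp [hy]))
      have hpm : p ∈ colWord T := by
        have := chain_subset_head _ _ hp
        cases T with
        | nil => simp at this
        | cons A L => simp only [List.headD_cons] at this; simp [colWord, mem_desc, this]
      have hpm' : m ≤ p := hm p hpm
      have hpeq : p = m := by
        by_contra hne
        exact hc (hlow m hmc (by omega))
      obtain ⟨u, y, huy, hu, hy⟩ := ih T' hT' hr'.of_append_left hm' (by
        rw [heq, hpeq]; simp)
      refine ⟨u, y ++ [x], hck.trans ?_, hu, by simp; omega⟩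
      rw [← List.append_assoc]
      exact huy.right _
    · obtain ⟨u, y, huy, hu, hy⟩ := ih T hT hr hm hmc
      exact ⟨u, y, huy, hu, by omega⟩

/-! ### Edelman–Greene column insertion -/

/-- Insert a letter on the left into a column, listed increasingly; the second component holds
the bumped letter, if any. -/
def ins (a : ℕ) : List ℕ → List ℕ × List ℕ
  | [] => ([a], [])
  | y :: L =>
    if a < y then (a :: L, [y])
    else if a = y then (y :: L, [y + 1])
    else (y :: (ins a L).1, (ins a L).2)

theorem ins_of_lt {a y : ℕ} (L : List ℕ) (h : a < y) : ins a (y :: L) = (a :: L, [y]) := by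
  simp [ins, h]

theorem ins_self (a : ℕ) (L : List ℕ) : ins a (a :: L) = (a :: L, [a + 1]) := by
  simp [ins]

theorem ins_of_gt {a y : ℕ} (L : List ℕ) (h : y < a) :
    ins a (y :: L) = (y :: (ins a L).1, (ins a L).2) := by
  simp [ins, h.not_gt, h.ne']

theorem mem_ins_fst {a x : ℕ} {X : List ℕ} (h : x ∈ (ins a X).1) : x = a ∨ x ∈ X := by
  induction X with
  | nil => simpa [ins] using h
  | cons y L ih =>
    rcases lt_trichotomy a y with hlt | rfl | hgt
    · rw [ins_of_lt L hlt] at h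
      grind
    · rw [ins_self] at h
      grind
    · rw [ins_of_gt L hgt] at h
      grind

theorem self_mem_ins (a : ℕ) (X : List ℕ) : a ∈ (ins a X).1 := by
  induction X with
  | nil => simp [ins]
  | cons y L ih =>
    rcases lt_trichotomy a y with hlt | rfl | hgt
    · simp [ins_of_lt L hlt]
    · simp [ins_self]
    · simp [ins_of_gt L hgt, ih]

theorem ins_sorted (a : ℕ) {X : List ℕ} (h : X.Pairwise (· < ·)) :
    (ins a X).1.Pairwise (· < ·) := by
  induction X with
  | nil => simp [ins]
  | cons y L ih =>
    rw [List.pairwise_cons] at h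
    rcases lt_trichotomy a y with hlt | rfl | hgt
    · rw [ins_of_lt L hlt, List.pairwise_cons]
      exact ⟨fun x hx => hlt.trans (h.1 x hx), h.2⟩
    · rw [ins_self, List.pairwise_cons]
      exact h
    · rw [ins_of_gt L hgt, List.pairwise_cons]
      refine ⟨fun x hx => ?_, ih h.2⟩
      rcases mem_ins_fst hx with rfl | hx
      · exact hgt
      · exact h.1 x hx

theorem ins_snd_cases (a : ℕ) (X : List ℕ) :
    (ins a X).2 = [] ∨ ∃ p, (ins a X).2 = [p] ∧ a < p := by
  induction X with
  | nil => simp [ins]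
  | cons y L ih =>
    rcases lt_trichotomy a y with hlt | rfl | hgt
    · simp [ins_of_lt L hlt, hlt]
    · simp [ins_self]
    · simpa [ins_of_gt L hgt] using ih

theorem lt_of_mem_ins_snd {a c p : ℕ} {X : List ℕ} (hX : ∀ x ∈ X, c < x)
    (hp : p ∈ (ins a X).2) : c < p := by
  induction X with
  | nil => simp [ins] at hp
  | cons y L ih =>
    have hy := hX y (by simp)
    rcases lt_trichotomy a y with hlt | rfl | hgt
    · rw [ins_of_lt L hlt] at hp
      simp only [List.mem_singleton] at hp
      omega
    · rw [ins_self] at hp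
      simp only [List.mem_singleton] at hp
      omega
    · rw [ins_of_gt L hgt] at hp
      exact ih (fun x hx => hX x (by simp [hx])) hp

theorem ins_snd_of_mem {x z : ℕ} (hxz : x < z) {X : List ℕ} (hz : z ∈ X)
    (hX : X.Pairwise (· < ·)) : ∃ p, (ins x X).2 = [p] ∧ p ≤ z := by
  induction X with
  | nil => simp at hz
  | cons y L ih =>
    rw [List.pairwise_cons] at hX
    rcases lt_trichotomy x y with hlt | rfl | hgt
    · refine ⟨y, by simp [ins_of_lt L hlt], ?_⟩
      rcases List.mem_cons.1 hz with rfl | hz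
      · exact le_rfl
      · exact (hX.1 z hz).le
    · exact ⟨x + 1, by simp [ins_self], hxz⟩
    · rw [ins_of_gt L hgt]
      refine ih ?_ hX.2
      rcases List.mem_cons.1 hz with rfl | hz
      · omega
      · exact hz

theorem ins_ins_lt {x z p : ℕ} (hzx : z < x) {X : List ℕ} (hX : X.Pairwise (· < ·))
    (hp : p ∈ (ins x (ins z X).1).2) : ∃ q, (ins z X).2 = [q] ∧ q < p := by
  induction X with
  | nil => simp [ins, hzx.not_gt, hzx.ne'] at hp
  | cons y L ih =>
    rw [List.pairwise_cons] at hX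
    rcases lt_trichotomy z y with hlt | rfl | hgt
    · rw [ins_of_lt L hlt, ins_of_gt L hzx] at hp
      exact ⟨y, by simp [ins_of_lt L hlt], lt_of_mem_ins_snd hX.1 hp⟩
    · rw [ins_self, ins_of_gt L hzx] at hp
      refine ⟨z + 1, by simp [ins_self], ?_⟩
      rcases ins_snd_cases x L with h | ⟨p', h, hp'⟩
      · simp [h] at hp
      · rw [h, List.mem_singleton] at hp
        omega
    · rw [ins_of_gt L hgt, ins_of_gt _ (hgt.trans hzx)] at hp
      rw [ins_of_gt L hgt]
      exact ih hX.2 hp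

/-- Insert the letters of a word from right to left. -/
def insW : List ℕ → List ℕ → List ℕ × List ℕ
  | [], X => (X, [])
  | a :: w, X => ((ins a (insW w X).1).1, (ins a (insW w X).1).2 ++ (insW w X).2)

/-- All insertions of equal letters meet a successor. -/
def GoodW : List ℕ → List ℕ → Prop
  | [], _ => True
  | a :: w, X => GoodW w X ∧ (a ∈ (insW w X).1 → a + 1 ∈ (insW w X).1)

theorem insW_append (u v X : List ℕ) : insW (u ++ v) X =
    ((insW u (insW v X).1).1, (insW u (insW v X).1).2 ++ (insW v X).2) := by
  induction u with
  | nil => simp [insW]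
  | cons a u ih => simp [insW, ih]

theorem goodW_append (u v X : List ℕ) :
    GoodW (u ++ v) X ↔ GoodW v X ∧ GoodW u (insW v X).1 := by
  induction u with
  | nil => simp [GoodW]
  | cons a u ih => simp [GoodW, ih, insW_append, and_assoc]

theorem insW_sorted (w : List ℕ) {X : List ℕ} (h : X.Pairwise (· < ·)) :
    (insW w X).1.Pairwise (· < ·) := by
  induction w with
  | nil => exact h
  | cons a w ih => exact ins_sorted a ih

theorem insW_of_gt {c : ℕ} {w : List ℕ} (hw : ∀ a ∈ w, c < a) (L : List ℕ) :
    insW w (c :: L) = (c :: (insW w L).1, (insW w L).2) := by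
  induction w with
  | nil => simp [insW]
  | cons a w ih =>
    rw [insW, ih (fun x hx => hw x (by simp [hx])), ins_of_gt _ (hw a (by simp)), insW]

theorem goodW_of_gt {c : ℕ} {w : List ℕ} (hw : ∀ a ∈ w, c < a) (L : List ℕ) :
    GoodW w (c :: L) ↔ GoodW w L := by
  induction w with
  | nil => simp [GoodW]
  | cons a w ih =>
    have hw' : ∀ x ∈ w, c < x := fun x hx => hw x (by simp [hx])
    have ha := hw a (by simp)
    rw [GoodW, GoodW, ih hw', insW_of_gt hw']
    simp [ha.ne', show a + 1 ≠ c by omega]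

theorem insW_rowLT (X Y : List ℕ) (h : RowLT X Y) (hX : X.Pairwise (· < ·)) :
    insW X.reverse Y = (X, Y.reverse) := by
  induction X generalizing Y with
  | nil =>
    cases Y with
    | nil => rfl
    | cons y Y => exact h.elim
  | cons x X ih =>
    rw [List.pairwise_cons] at hX
    have hX' : ∀ a ∈ X.reverse, x < a := fun a ha => hX.1 a (by simpa using ha)
    rw [List.reverse_cons, insW_append]
    cases Y with
    | nil => simp [insW, ins, insW_of_gt hX', ih [] (by cases X <;> trivial) hX.2]
    | cons y Y => simp [insW, ins_of_lt Y h.1, insW_of_gt hX', ih Y h.2 hX.2]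

theorem insW_colWord (A : Finset ℕ) (L : List (Finset ℕ)) (h : TabChain (A :: L)) :
    insW (colWord (A :: L)) [] = (A.sort, colWord L) := by
  induction L generalizing A with
  | nil =>
    have := insW_rowLT A.sort [] (by cases A.sort <;> trivial) A.sortedLT_sort.pairwise
    simpa [colWord, desc] using this
  | cons B L ih =>
    rw [colWord, insW_append, ih B h.2]
    have := insW_rowLT A.sort B.sort (rowLT_sort h.1) A.sortedLT_sort.pairwise
    simp only [colWord, desc, this]

/-! ### Insertion and Coxeter–Knuth equivalence -/

theorem good_of_reduced {a : ℕ} {X : List ℕ} (hX : X.Pairwise (· < ·))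
    (hr : IsReducedWord (a :: X.reverse)) (ha : a ∈ X) : a + 1 ∈ X := by
  by_contra hn
  obtain ⟨s, t, rfl⟩ := List.append_of_mem ha
  rw [List.pairwise_append, List.pairwise_cons] at hX
  refine not_reduced_runD (p := a) (n := 0) (A := []) (B := t.reverse) (by simp) ?_
    (IsReducedWord.of_append_left (b := s.reverse) (by simpa [runD] using hr))
  intro x hx
  rw [List.mem_reverse] at hx
  have h1 := hX.2.1.1 x hx
  have : x ≠ a + 1 := by
    rintro rfl
    exact hn (by simp [hx])
  omega

theorem ins_ck {a : ℕ} {X : List ℕ} (hX : X.Pairwise (· < ·)) (hg : a ∈ X → a + 1 ∈ X) :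
    CKEquiv (a :: X.reverse) ((ins a X).1.reverse ++ (ins a X).2) := by
  induction X with
  | nil => exact .of_eq (by simp [ins])
  | cons y L ih =>
    have hX0 := hX
    rw [List.pairwise_cons] at hX
    rcases lt_trichotomy a y with hlt | rfl | hgt
    · rw [ins_of_lt L hlt]
      have := ck_bump hlt L.reverse [] (by
        rw [← List.reverse_cons, List.pairwise_reverse]; exact hX0) (by simp)
      simpa using this
    · rw [ins_self]
      have h1 : a + 1 ∈ L := by
        have := hg (by simp)
        simpa using this
      obtain ⟨L, rfl⟩ : ∃ L', L = (a + 1) :: L' := by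
        cases L with
        | nil => simp at h1
        | cons h L =>
          refine ⟨L, ?_⟩
          have h2 := hX.1 h (by simp)
          rcases List.mem_cons.1 h1 with h3 | h3
          · rw [h3]
          · have := (List.pairwise_cons.1 hX.2).1 _ h3
            omega
      have := ck_bump_succ a L.reverse [] (by
        rw [← List.reverse_cons, List.pairwise_reverse]; exact hX.2) (by simp)
      simpa using this
    · rw [ins_of_gt L hgt]
      have h1 := (ih hX.2 (fun h => by
        have := hg (by simp [h])
        rcases List.mem_cons.1 this with h3 | h3
        · omega
        · exact h3)).right [y]
      simp only [List.reverse_cons, List.cons_append, List.append_assoc] at h1 ⊢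
      refine h1.trans ?_
      rcases ins_snd_cases a L with h | ⟨p, h, hp⟩
      · rw [h]
        exact .of_eq (by simp)
      · rw [h]
        cases hL : (ins a L).1 with
        | nil =>
          have := self_mem_ins a L
          simp [hL] at this
        | cons z M =>
          have hz : y < z := by
            rcases mem_ins_fst (a := a) (x := z) (X := L) (by simp [hL]) with rfl | hz
            · exact hgt
            · exact hX.1 z hz
          have hza : z ≤ a := by
            have h4 := self_mem_ins a L
            have h5 := ins_sorted a hX.2
            rw [hL] at h4 h5
            rcases List.mem_cons.1 h4 with h6 | h6
            · omega
            · exact ((List.pairwise_cons.1 h5).1 a h6).le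
          have := (CKEquiv.swap_right (x := z) (y := y) (z := p) hz (by omega)).symm.left M.reverse
          simpa using this

theorem insW_ck {w X : List ℕ} (hX : X.Pairwise (· < ·)) (hg : GoodW w X) :
    CKEquiv (w ++ X.reverse) ((insW w X).1.reverse ++ (insW w X).2) := by
  induction w with
  | nil => exact .of_eq (by simp [insW])
  | cons a w ih =>
    have h1 := (ih hg.1).cons a
    have h2 := (ins_ck (insW_sorted w hX) hg.2).right (insW w X).2
    simpa [insW] using h1.trans h2

theorem goodW_of_reduced {w X : List ℕ} (hX : X.Pairwise (· < ·))
    (hr : IsReducedWord (w ++ X.reverse)) : GoodW w X := by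
  induction w with
  | nil => trivial
  | cons a w ih =>
    have hw : GoodW w X := ih (IsReducedWord.of_append_right (a := [a]) (by simpa using hr))
    refine ⟨hw, good_of_reduced (insW_sorted w hX) ?_⟩
    have := hr.of_ck ((insW_ck hX hw).cons a)
    rw [← List.cons_append] at this
    exact this.of_append_left

/-- `u` and `v` are inserted to the same column, with equivalent output. -/
def SameIns (u v X : List ℕ) : Prop :=
  (insW u X).1 = (insW v X).1 ∧ CKEquiv (insW u X).2 (insW v X).2

theorem sameIns_cons {c : ℕ} {u v L : List ℕ} (hu : ∀ a ∈ u, c < a) (hv : ∀ a ∈ v, c < a)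
    (h : SameIns u v L) : SameIns u v (c :: L) := by
  rw [SameIns, insW_of_gt hu, insW_of_gt hv]
  exact ⟨by rw [h.1], h.2⟩

theorem head_eq_succ {a : ℕ} {L : List ℕ} (hX : (a :: L).Pairwise (· < ·)) (h : a + 1 ∈ L) :
    ∃ L', L = (a + 1) :: L' := by
  cases L with
  | nil => simp at h
  | cons b L =>
    rw [List.pairwise_cons, List.pairwise_cons] at hX
    have h2 := hX.1 b (by simp)
    rcases List.mem_cons.1 h with h3 | h3
    · exact ⟨L, by rw [h3]⟩
    · have := hX.2.1 _ h3
      omega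

/-! ### Invariance of the insertion under Coxeter–Knuth moves -/

theorem sameIns_swap_right {x y z : ℕ} (h1 : y < x) (h2 : x < z) {X : List ℕ}
    (hX : X.Pairwise (· < ·)) (hu : GoodW [x, y, z] X) (hv : GoodW [x, z, y] X) :
    SameIns [x, y, z] [x, z, y] X := by
  have h3 := h1.trans h2
  induction X with
  | nil => simp [SameIns, insW, ins, h1.not_gt, h2, h1.ne', h3, h3.not_gt, h3.ne', CKEquiv.refl]
  | cons c L ih =>
    have hX0 := hX
    rw [List.pairwise_cons] at hX
    rcases lt_trichotomy y c with hy | rfl | hy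
    · rcases lt_trichotomy z c with hz | rfl | hz
      · cases L with
        | nil =>
          simp [SameIns, insW, ins, h1.not_gt, h2, h1.ne', h3, h3.not_gt, h3.ne', hy, hz,
            CKEquiv.refl]
        | cons d L =>
          have hd := hX.1 d (by simp)
          have := CKEquiv.swap_left (x := d) (y := z) (z := c) hz hd
          simpa [SameIns, insW, ins_of_lt, ins_of_gt, hy, hz, h1, h2, h3, hz.trans hd,
            h2.trans (hz.trans hd)] using this
      · have hz : z + 1 ∈ L := by
          have := hu.1.1.2
          simpa [insW] using this
        obtain ⟨L, rfl⟩ := head_eq_succ hX0 hz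
        have := CKEquiv.braid z
        simpa [SameIns, insW, ins_of_lt, ins_of_gt, ins_self, h1, h2, h3, show x < z + 1 by omega]
          using this.symm
      · obtain ⟨p, hp, hpz⟩ := ins_snd_of_mem h2 (self_mem_ins z L) (ins_sorted z hX.2)
        have hcp : c < p := lt_of_mem_ins_snd (X := (ins z L).1) (a := x) (fun a ha => by
          rcases mem_ins_fst ha with rfl | ha
          · exact hz
          · exact hX.1 a ha) (by simp [hp])
        rcases ins_snd_cases z L with ho | ⟨q, ho, hq⟩
        · simp [SameIns, insW, ins_of_lt, ins_of_gt, hy, hz, h1, h3, hp, ho, CKEquiv.refl]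
        · have := CKEquiv.swap_right (x := p) (y := c) (z := q) hcp (by omega)
          simpa [SameIns, insW, ins_of_lt, ins_of_gt, hy, hz, h1, h3, hp, ho] using this
    · obtain ⟨p, hp, hpz⟩ := ins_snd_of_mem h2 (self_mem_ins z L) (ins_sorted z hX.2)
      have hxp : x < p := by
        rcases ins_snd_cases x (ins z L).1 with h | ⟨p', h, hp'⟩
        · simp [h] at hp
        · rw [h] at hp
          simp only [List.cons.injEq, and_true] at hp
          omega
      rcases ins_snd_cases z L with ho | ⟨q, ho, hq⟩
      · simp [SameIns, insW, ins_of_gt, ins_self, h1, h3, hp, ho, CKEquiv.refl]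
      · have := CKEquiv.swap_right (x := p) (y := y + 1) (z := q) (by omega) (by omega)
        simpa [SameIns, insW, ins_of_gt, ins_self, h1, h3, hp, ho] using this
    · have m1 : ∀ a ∈ [x, y, z], c < a := by simp; omega
      have m2 : ∀ a ∈ [x, z, y], c < a := by simp; omega
      exact sameIns_cons m1 m2 (ih hX.2 ((goodW_of_gt m1 L).1 hu) ((goodW_of_gt m2 L).1 hv))

theorem sameIns_swap_left {x y z : ℕ} (h1 : y < z) (h2 : z < x) {X : List ℕ}
    (hX : X.Pairwise (· < ·)) (hu : GoodW [x, y, z] X) (hv : GoodW [y, x, z] X) :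
    SameIns [x, y, z] [y, x, z] X := by
  have h3 := h1.trans h2
  induction X with
  | nil => simp [SameIns, insW, ins, h1, h2.not_gt, h2.ne', h3.not_gt, h3.ne', CKEquiv.refl]
  | cons c L ih =>
    have hX0 := hX
    rw [List.pairwise_cons] at hX
    rcases lt_trichotomy z c with hz | rfl | hz
    · rcases ins_snd_cases x L with ho | ⟨p, ho, hp⟩
      · simp [SameIns, insW, ins_of_lt, ins_of_gt, hz, h1, h2, h3, ho, CKEquiv.refl]
      · have hcp : c < p := lt_of_mem_ins_snd hX.1 (by rw [ho]; simp)
        have := CKEquiv.swap_left (x := p) (y := z) (z := c) hz hcp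
        simpa [SameIns, insW, ins_of_lt, ins_of_gt, hz, h1, h2, h3, ho] using this
    · rcases ins_snd_cases x L with ho | ⟨p, ho, hp⟩
      · simp [SameIns, insW, ins_of_lt, ins_of_gt, ins_self, h1, h2, h3, ho, CKEquiv.refl]
      · have := CKEquiv.swap_left (x := p) (y := z) (z := z + 1) (by omega) (by omega)
        simpa [SameIns, insW, ins_of_lt, ins_of_gt, ins_self, h1, h2, h3, ho] using this
    · rcases lt_trichotomy y c with hy | rfl | hy
      · rcases ins_snd_cases x (ins z L).1 with ho | ⟨p, ho, hp⟩
        · simp [SameIns, insW, ins_of_lt, ins_of_gt, hz, hy, h3, hz.trans h2, ho, CKEquiv.refl]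
        · obtain ⟨q, hq, hqp⟩ := ins_ins_lt h2 hX.2 (p := p) (by simp [ho])
          have hcq : c < q := lt_of_mem_ins_snd hX.1 (by rw [hq]; simp)
          have := CKEquiv.swap_left (x := p) (y := c) (z := q) hcq hqp
          simpa [SameIns, insW, ins_of_lt, ins_of_gt, hz, hy, h3, hz.trans h2, ho, hq] using this
      · rcases ins_snd_cases x (ins z L).1 with ho | ⟨p, ho, hp⟩
        · simp [SameIns, insW, ins_of_gt, ins_self, hz, h3, ho, CKEquiv.refl]
        · obtain ⟨q, hq, hqp⟩ := ins_ins_lt h2 hX.2 (p := p) (by simp [ho])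
          have hzq : z < q := by
            rcases ins_snd_cases z L with h | ⟨q', h, hq'⟩
            · simp [h] at hq
            · rw [h] at hq
              simp only [List.cons.injEq, and_true] at hq
              omega
          have := CKEquiv.swap_left (x := p) (y := y + 1) (z := q) (by omega) hqp
          simpa [SameIns, insW, ins_of_gt, ins_self, hz, h3, ho, hq] using this
      · have m1 : ∀ a ∈ [x, y, z], c < a := by simp; omega
        have m2 : ∀ a ∈ [y, x, z], c < a := by simp; omega
        exact sameIns_cons m1 m2 (ih hX.2 ((goodW_of_gt m1 L).1 hu) ((goodW_of_gt m2 L).1 hv))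

theorem sameIns_braid {i : ℕ} {X : List ℕ} (hX : X.Pairwise (· < ·))
    (hu : GoodW [i, i + 1, i] X) (hv : GoodW [i + 1, i, i + 1] X) :
    SameIns [i, i + 1, i] [i + 1, i, i + 1] X := by
  have h3 : i < i + 1 := by omega
  induction X with
  | nil => simp [SameIns, insW, ins, CKEquiv.refl]
  | cons c L ih =>
    have hX0 := hX
    rw [List.pairwise_cons] at hX
    rcases lt_trichotomy i c with hi | rfl | hi
    · rcases lt_trichotomy (i + 1) c with hi1 | rfl | hi1
      · rcases ins_snd_cases (i + 1) L with ho | ⟨p, ho, hp⟩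
        · simp [SameIns, insW, ins_of_lt, ins_of_gt, ins_self, hi, hi1, ho, CKEquiv.refl]
        · have hcp : c < p := lt_of_mem_ins_snd hX.1 (by rw [ho]; simp)
          have := CKEquiv.swap_left (x := p) (y := i + 1) (z := c) hi1 hcp
          simpa [SameIns, insW, ins_of_lt, ins_of_gt, ins_self, hi, hi1, ho] using this.symm
      · have hz : i + 1 + 1 ∈ L := by
          have := hv.1.1.2
          simpa [insW] using this
        obtain ⟨L, rfl⟩ := head_eq_succ hX0 hz
        have := CKEquiv.braid (i + 1)
        simpa [SameIns, insW, ins_of_lt, ins_of_gt, ins_self] using this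
      · omega
    · have hz : i + 1 ∈ L := by
        have := hu.1.1.2
        simpa [insW] using this
      obtain ⟨L, rfl⟩ := head_eq_succ hX0 hz
      have := CKEquiv.braid (i + 1)
      simpa [SameIns, insW, ins_of_lt, ins_of_gt, ins_self] using this
    · have m1 : ∀ a ∈ [i, i + 1, i], c < a := by simp; omega
      have m2 : ∀ a ∈ [i + 1, i, i + 1], c < a := by simp; omega
      exact sameIns_cons m1 m2 (ih hX.2 ((goodW_of_gt m1 L).1 hu) ((goodW_of_gt m2 L).1 hv))

theorem sameIns_infix {u v X : List ℕ} (a b : List ℕ) (h : SameIns u v (insW b X).1) :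
    SameIns (a ++ u ++ b) (a ++ v ++ b) X := by
  obtain ⟨h1, h2⟩ := h
  rw [SameIns, insW_append, insW_append, insW_append, insW_append, h1]
  exact ⟨rfl, (h2.left _).right _⟩

theorem CKEquiv.sameIns {u v X : List ℕ} (h : CKEquiv u v) (hX : X.Pairwise (· < ·))
    (hr : IsReducedWord (u ++ X.reverse)) : SameIns u v X := by
  induction h with
  | rel u v h =>
    have hg := goodW_of_reduced hX hr
    have hg' := goodW_of_reduced hX (hr.of_ck (CKEquiv.right X.reverse (.rel _ _ h)))
    rcases h with ⟨a, b, x, y, z, h1, h2, rfl, rfl⟩ | ⟨a, b, x, y, z, h1, h2, rfl, rfl⟩ |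
      ⟨a, b, i, rfl, rfl⟩
    all_goals
      rw [List.append_assoc, goodW_append, goodW_append] at hg hg'
      apply sameIns_infix
    · exact sameIns_swap_right h1 h2 (insW_sorted b hX) hg.1.2 hg'.1.2
    · exact sameIns_swap_left h1 h2 (insW_sorted b hX) hg.1.2 hg'.1.2
    · exact sameIns_braid (insW_sorted b hX) hg.1.2 hg'.1.2
  | refl u => exact ⟨rfl, .refl _⟩
  | symm u v h ih =>
    have := ih (hr.of_ck (CKEquiv.symm (CKEquiv.right _ h)))
    exact ⟨this.1.symm, this.2.symm⟩
  | trans u v w h1 h2 ih1 ih2 =>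
    have e1 := ih1 hr
    have e2 := ih2 (hr.of_ck (CKEquiv.right _ h1))
    exact ⟨e1.1.trans e2.1, e1.2.trans e2.2⟩

theorem chain_succ_eq (T : List (Finset ℕ)) (c : ℕ) :
    chain T (c + 1) = matched (T.headD ∅) (chain T.tail c) := by
  cases T with
  | nil => exact (Finset.subset_empty.1 (matched_subset _ _)).symm
  | cons A L => rfl

theorem colWord_eq (T : List (Finset ℕ)) :
    colWord T = desc (T.headD ∅) ++ colWord T.tail := by
  cases T <;> simp [colWord]

theorem TabChain.tail {T : List (Finset ℕ)} (h : TabChain T) : TabChain T.tail := by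
  cases T with
  | nil => trivial
  | cons A L => exact h.2

theorem TabChain.insW_colWord {T : List (Finset ℕ)} (h : TabChain T) :
    insW (colWord T) [] = ((T.headD ∅).sort, colWord T.tail) := by
  cases T with
  | nil => simp [insW, colWord]
  | cons A L => exact _root_.insW_colWord A L h

theorem head_tail_of_ck {T T' : List (Finset ℕ)} (hT : TabChain T) (hT' : TabChain T')
    (hr : IsReducedWord (colWord T)) (h : CKEquiv (colWord T) (colWord T')) :
    T.headD ∅ = T'.headD ∅ ∧ CKEquiv (colWord T.tail) (colWord T'.tail) := by
  have hs := h.sameIns (X := []) (by simp) (by simpa using hr)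
  rw [SameIns, hT.insW_colWord, hT'.insW_colWord] at hs
  refine ⟨?_, hs.2⟩
  have := congrArg List.toFinset hs.1
  simpa only [Finset.sort_toFinset] using this

/-- The key columns of a tableau only depend on the equivalence class of its reading word. -/
theorem chain_eq_of_ck {T T' : List (Finset ℕ)} (hT : TabChain T) (hT' : TabChain T')
    (hr : IsReducedWord (colWord T)) (h : CKEquiv (colWord T) (colWord T')) (c : ℕ) :
    chain T c = chain T' c := by
  obtain ⟨hhead, htail⟩ := head_tail_of_ck hT hT' hr h
  induction c generalizing T T' with
  | zero => rw [chain_zero, chain_zero, hhead]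
  | succ c ih =>
    have hr' : IsReducedWord (colWord T.tail) := by
      rw [colWord_eq] at hr
      exact hr.of_append_right
    obtain ⟨hhead', htail'⟩ := head_tail_of_ck hT.tail hT'.tail hr' htail
    rw [chain_succ_eq, chain_succ_eq, hhead, ih hT.tail hT'.tail hr' htail hhead' htail']

/-! ### Reversal and row extraction -/

theorem CKEquiv.reverse {u v : List ℕ} (h : CKEquiv u v) : CKEquiv u.reverse v.reverse := by
  induction h with
  | rel u v h =>
    rcases h with ⟨a, b, x, y, z, h1, h2, rfl, rfl⟩ | ⟨a, b, x, y, z, h1, h2, rfl, rfl⟩ |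
      ⟨a, b, i, rfl, rfl⟩
    · have := (CKEquiv.swap_left (x := z) (y := y) (z := x) h1 h2).symm.infix_congr b.reverse
        a.reverse
      simpa using this.symm
    · have := (CKEquiv.swap_right (x := z) (y := y) (z := x) h1 h2).symm.infix_congr b.reverse
        a.reverse
      simpa using this.symm
    · have := (CKEquiv.braid i).infix_congr b.reverse a.reverse
      simpa using this
  | refl u => exact .refl _
  | symm u v h ih => exact ih.symm
  | trans u v w h1 h2 ih1 ih2 => exact ih1.trans ih2

theorem wordPerm_reverse (u : List ℕ) : wordPerm u.reverse = (wordPerm u)⁻¹ := by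
  induction u with
  | nil => simp
  | cons a u ih =>
    rw [List.reverse_cons, wordPerm_append, ih, wordPerm_cons, wordPerm_cons, wordPerm_nil,
      mul_one, mul_inv_rev, inv_eq_of_mul_eq_one_left (sPerm_mul_self a)]

theorem IsReducedWord.reverse {u : List ℕ} (h : IsReducedWord u) : IsReducedWord u.reverse := by
  refine ⟨fun x hx => h.1 x (by simpa using hx), fun σ hσ he => ?_⟩
  have := h.2 σ.reverse (fun x hx => hσ x (by simpa using hx)) (by
    rw [wordPerm_reverse, he, wordPerm_reverse, inv_inv])
  simpa using this

theorem exists_lt_of_mem_insW_snd {w X : List ℕ} {p : ℕ} (hp : p ∈ (insW w X).2) :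
    ∃ a ∈ w, a < p := by
  induction w with
  | nil => simp [insW] at hp
  | cons a w ih =>
    rw [insW, List.mem_append] at hp
    rcases hp with hp | hp
    · rcases ins_snd_cases a (insW w X).1 with h | ⟨q, h, hq⟩
      · simp [h] at hp
      · rw [h, List.mem_singleton] at hp
        exact ⟨a, by simp, by omega⟩
    · obtain ⟨b, hb, hbp⟩ := ih hp
      exact ⟨b, by simp [hb], hbp⟩

/-- Every reduced word is equivalent to one ending in an increasing word, preceded only by
letters that are not minimal. -/
theorem exists_row {y : List ℕ} (hr : IsReducedWord y) {m : ℕ} (hm : ∀ x ∈ y, m ≤ x) :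
    ∃ z v, CKEquiv y (z ++ v) ∧ v.Pairwise (· < ·) ∧ (∀ x ∈ z, m < x) ∧ ∀ x ∈ v, m ≤ x := by
  have hX : ([] : List ℕ).Pairwise (· < ·) := by simp
  have hck := (insW_ck hX (goodW_of_reduced hX (w := y.reverse)
      (by simpa using hr.reverse))).reverse
  simp only [List.reverse_nil, List.append_nil, List.reverse_reverse, List.reverse_append] at hck
  refine ⟨_, _, hck, insW_sorted _ hX, fun x hx => ?_, fun x hx => ?_⟩
  · obtain ⟨a, ha, hax⟩ := exists_lt_of_mem_insW_snd (List.mem_reverse.1 hx)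
    have := hm a (by simpa using ha)
    omega
  · exact hm x ((hck.mem_iff x).2 (by simp [hx]))

/-! ### The key statistic -/

theorem exists_tab {w : List ℕ} (hr : IsReducedWord w) :
    ∃ T, TabChain T ∧ CKEquiv w (colWord T) := by
  obtain ⟨T, h1, h2, -⟩ := exists_insert_word (L := []) trivial w (by simpa [colWord] using hr)
  exact ⟨T, h2, by simpa [colWord] using h1⟩

theorem chain_mono {T T' : List (Finset ℕ)} (hT : TabChain T) (hT' : TabChain T') {w : List ℕ}
    (hr : IsReducedWord (colWord T')) (h : CKEquiv (colWord T ++ w) (colWord T')) (c : ℕ) :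
    chain T c ⊆ chain T' c := by
  have hr' := hr.of_ck h.symm
  obtain ⟨T2, h1, h2, h3⟩ := exists_insert_word hT w hr'
  rw [← chain_eq_of_ck h2 hT' (hr'.of_ck h1) (h1.symm.trans h)]
  exact h3 c

theorem mem_colWord_of_mem_chain {T : List (Finset ℕ)} {c x : ℕ} (h : x ∈ chain T c) :
    x ∈ colWord T := by
  rw [colWord_eq, List.mem_append, mem_desc]
  exact Or.inl (chain_subset_head T c h)

theorem chain_eq_empty {T : List (Finset ℕ)} (hT : TabChain T) {c : ℕ} (hc : T.length ≤ c) :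
    chain T c = ∅ := by
  rw [← Finset.card_eq_zero, card_chain hT, List.getD_eq_default _ _ hc, Finset.card_empty]

theorem sum_card_chain {T : List (Finset ℕ)} (hT : TabChain T) {N : ℕ} (hN : T.length ≤ N) :
    ∑ c ∈ Finset.range N, (chain T c).card = (colWord T).length := by
  simp only [card_chain hT]
  clear hT
  induction T generalizing N with
  | nil => simp [colWord]
  | cons A L ih =>
    obtain ⟨N, rfl⟩ : ∃ N', N = N' + 1 := ⟨N - 1, by simp at hN; omega⟩
    rw [Finset.sum_range_succ']
    simp only [List.getD_cons_succ, List.getD_cons_zero]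
    rw [ih (by simpa using hN), colWord, List.length_append, desc_length, add_comm]

/-- The number of entries exceeding `k` in the first `N` key columns. -/
noncomputable def keyCount (T : List (Finset ℕ)) (N k : ℕ) : ℕ :=
  ∑ c ∈ Finset.range N, ((chain T c).filter (k < ·)).card

theorem keyCount_stable {T : List (Finset ℕ)} (hT : TabChain T) {N N' k : ℕ}
    (hN : T.length ≤ N) (hN' : N ≤ N') : keyCount T N' k = keyCount T N k := by
  refine (Finset.sum_subset (Finset.range_mono hN') fun c _ hc => ?_).symm
  rw [Finset.mem_range, not_lt] at hc
  simp [chain_eq_empty hT (hN.trans hc)]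

theorem keyCount_total {T : List (Finset ℕ)} (hT : TabChain T) {N k : ℕ} (hN : T.length ≤ N)
    (hk : ∀ x ∈ colWord T, k < x) : keyCount T N k = (colWord T).length := by
  rw [← sum_card_chain hT hN, keyCount]
  refine Finset.sum_congr rfl fun c _ => ?_
  rw [Finset.filter_true_of_mem fun x hx => hk x (mem_colWord_of_mem_chain hx)]

theorem length_prefix_le_keyCount {T : List (Finset ℕ)} (hT : TabChain T)
    (hr : IsReducedWord (colWord T)) {u v : List ℕ} (h : CKEquiv (u ++ v) (colWord T)) {N k : ℕ}
    (hN : T.length ≤ N) (hu : ∀ x ∈ u, k < x) : u.length ≤ keyCount T N k := by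
  obtain ⟨T1, hT1, h1⟩ := exists_tab (hr.of_ck h.symm).of_append_left
  have hsub := chain_mono hT1 hT hr ((h1.symm.right v).trans h)
  rw [h1.length_eq, ← keyCount_total hT1 (le_max_right N T1.length) (k := k)
    (fun x hx => hu x ((h1.mem_iff x).2 hx)), ← keyCount_stable hT hN (le_max_left N T1.length)]
  exact Finset.sum_le_sum fun c _ => Finset.card_le_card (Finset.filter_subset_filter _ (hsub c))

/-! ### Flagged factorizations realizing the key statistic -/

/-- Strictly increasing blocks, with the letters of each block bounded below by its index; the
last block has index `m`. -/
def Flagged (m : ℕ) : List (List ℕ) → Prop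
  | [] => True
  | F :: G => F.Pairwise (· < ·) ∧ (∀ x ∈ F, m + G.length ≤ x) ∧ Flagged m G

/-- The list of block indices, repeated according to the lengths of the blocks. -/
def blockRows (m : ℕ) : List (List ℕ) → List ℕ
  | [] => []
  | F :: G => List.replicate F.length (m + G.length) ++ blockRows m G

theorem Flagged.concat {m : ℕ} {G : List (List ℕ)} (h : Flagged (m + 1) G) {v : List ℕ}
    (hv : v.Pairwise (· < ·)) (hm : ∀ x ∈ v, m ≤ x) : Flagged m (G ++ [v]) := by
  induction G with
  | nil => exact ⟨hv, by simpa using hm, trivial⟩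
  | cons F G ih =>
    refine ⟨h.1, fun x hx => ?_, ih h.2.2⟩
    have := h.2.1 x hx
    change m + (G ++ [v]).length ≤ x
    rw [List.length_append, List.length_singleton]
    omega

theorem blockRows_concat (m : ℕ) (G : List (List ℕ)) (v : List ℕ) :
    blockRows m (G ++ [v]) = blockRows (m + 1) G ++ List.replicate v.length m := by
  induction G with
  | nil => simp [blockRows]
  | cons F G ih =>
    simp only [List.cons_append, blockRows, ih, List.append_assoc, List.length_append,
      List.length_singleton]
    rw [show m + (G.length + 1) = m + 1 + G.length by omega]

theorem le_of_mem_blockRows {m x : ℕ} {G : List (List ℕ)} (h : x ∈ blockRows m G) : m ≤ x := by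
  induction G with
  | nil => simp [blockRows] at h
  | cons F G ih =>
    rw [blockRows, List.mem_append, List.mem_replicate] at h
    rcases h with h | h
    · omega
    · exact ih h

theorem blockRows_length (m : ℕ) (G : List (List ℕ)) :
    (blockRows m G).length = G.flatten.length := by
  induction G with
  | nil => simp [blockRows]
  | cons F G ih => simp only [blockRows, List.length_append, List.length_replicate, ih,
      List.flatten_cons]

/-- Removing the letters `m` from the key, where `m` is minimal. -/
theorem exists_split {T : List (Finset ℕ)} (hT : TabChain T) (hr : IsReducedWord (colWord T))
    {m : ℕ} (hm : ∀ x ∈ colWord T, m ≤ x) : ∃ T' v, TabChain T' ∧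
      CKEquiv (colWord T) (colWord T' ++ v) ∧ v.Pairwise (· < ·) ∧ (∀ x ∈ v, m ≤ x) ∧
      (∀ x ∈ colWord T', m < x) ∧
      ∀ N k, T.length ≤ N → T'.length ≤ N → m ≤ k → keyCount T' N k = keyCount T N k := by
  have hex : ∃ c, m ∉ chain T c := ⟨T.length, by simp [chain_eq_empty hT le_rfl]⟩
  classical
  set c₀ := Nat.find hex with hc₀
  have hc1 : m ∉ chain T c₀ := Nat.find_spec hex
  have hc2 : ∀ c < c₀, m ∈ chain T c := fun c hc => not_not.1 (Nat.find_min hex hc)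
  obtain ⟨u, y, huy, hu, hy⟩ := exists_free_prefix m c₀ T hT hr hm hc1
  obtain ⟨z, v, hzv, hv, hz, hvm⟩ := exists_row (m := m) ((hr.of_ck huy).of_append_right)
    (fun x hx => hm x ((huy.mem_iff x).2 (by simp [hx])))
  have hck : CKEquiv (colWord T) ((u ++ z) ++ v) := by
    rw [List.append_assoc]
    exact huy.trans (hzv.left u)
  obtain ⟨T', hT', hck'⟩ := exists_tab (hr.of_ck hck).of_append_left
  have hck2 := hck.trans (hck'.right v)
  have hT'm : ∀ x ∈ colWord T', m < x := by
    intro x hx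
    rw [← hck'.mem_iff, List.mem_append] at hx
    rcases hx with hx | hx
    · have h1 := hm x ((huy.mem_iff x).2 (by simp [hx]))
      have : x ≠ m := by
        rintro rfl
        exact hu hx
      omega
    · exact hz x hx
  refine ⟨T', v, hT', hck2, hv, hvm, hT'm, ?_⟩
  intro N k hN hN' hk
  have hsub : ∀ c, chain T' c ⊆ (chain T c).erase m := fun c x hx => by
    rw [Finset.mem_erase]
    exact ⟨(hT'm x (mem_colWord_of_mem_chain hx)).ne', chain_mono hT' hT hr hck2.symm c hx⟩
  have hcN : c₀ ≤ N := by
    refine (Nat.find_min' hex ?_).trans hN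
    simp [chain_eq_empty hT le_rfl]
  have hsum : ∑ c ∈ Finset.range N, ((chain T c).erase m).card + c₀ ≤ (colWord T).length := by
    have h1 : ∑ c ∈ Finset.range N, (if c < c₀ then 1 else 0) = c₀ := by
      rw [Finset.sum_boole]
      simp only [Nat.cast_id]
      rw [show (Finset.range N).filter (· < c₀) = Finset.range c₀ by ext; simp; omega,
        Finset.card_range]
    rw [← sum_card_chain hT hN]
    conv_lhs => rw [← h1]
    rw [← Finset.sum_add_distrib]
    refine Finset.sum_le_sum fun c _ => ?_
    split_ifs with h
    · exact (Finset.card_erase_add_one (hc2 c h)).le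
    · exact Finset.card_le_card (Finset.erase_subset _ _)
  have hlen : (colWord T).length = (colWord T').length + v.length := by
    rw [hck2.length_eq, List.length_append]
  have hvy : v.length ≤ c₀ := by
    have := hzv.length_eq
    rw [List.length_append] at this
    omega
  have heq : ∀ c ∈ Finset.range N, chain T' c = (chain T c).erase m := by
    intro c hc
    refine Finset.eq_of_subset_of_card_le (hsub c) ?_
    by_contra hlt
    have := Finset.sum_lt_sum (s := Finset.range N) (fun c _ => Finset.card_le_card (hsub c))
      ⟨c, hc, not_le.1 hlt⟩
    rw [sum_card_chain hT' hN'] at this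
    omega
  refine Finset.sum_congr rfl fun c hc => ?_
  rw [heq c hc]
  congr 1
  ext x
  simp only [Finset.mem_filter, Finset.mem_erase]
  constructor
  · exact fun h => ⟨h.1.2, h.2⟩
  · exact fun h => ⟨⟨by omega, h.1⟩, h.2⟩

theorem exists_flagged (n m : ℕ) (T : List (Finset ℕ)) (hT : TabChain T)
    (hr : IsReducedWord (colWord T)) (hm : ∀ x ∈ colWord T, m ≤ x)
    (hn : ∀ x ∈ colWord T, x < m + n) :
    ∃ G, Flagged m G ∧ CKEquiv (colWord T) G.flatten ∧ ∀ N k, T.length ≤ N → m ≤ k + 1 →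
      (blockRows m G).countP (k < ·) = keyCount T N k := by
  induction n generalizing m T with
  | zero =>
    have h0 : colWord T = [] := List.eq_nil_iff_forall_not_mem.2 fun x hx => by
      have := hm x hx
      have := hn x hx
      omega
    refine ⟨[], trivial, .of_eq (by simp [h0]), fun N k hN _ => ?_⟩
    rw [keyCount_total hT hN (by simp [h0]), h0]
    rfl
  | succ n ih =>
    obtain ⟨T', v, hT', hck, hv, hvm, hT'm, hkey⟩ := exists_split hT hr hm
    obtain ⟨G, hG, hck', hcount⟩ := ih (m + 1) T' hT' (hr.of_ck hck).of_append_left hT'm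
      (fun x hx => by
        have := hn x ((hck.mem_iff x).2 (by simp [hx]))
        omega)
    have hck2 : CKEquiv (colWord T) (G ++ [v]).flatten := by
      simpa using hck.trans (hck'.right v)
    refine ⟨G ++ [v], hG.concat hv hvm, hck2, fun N k hN hk => ?_⟩
    by_cases hmk : m ≤ k
    · rw [← keyCount_stable hT hN (le_max_left N T'.length),
        ← hkey _ k (hN.trans (le_max_left _ _)) (le_max_right _ _) hmk,
        ← hcount _ k (le_max_right _ _) (by omega), blockRows_concat, List.countP_append]
      simp [List.countP_replicate, hmk]
    · rw [keyCount_total hT hN (fun x hx => by have := hm x hx; omega), hck2.length_eq,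
        ← blockRows_length m, List.countP_eq_length]
      intro x hx
      have := le_of_mem_blockRows hx
      simp
      omega

/-! ### Rows of the letters in the weak descent tableau -/

/-- The rows of the remaining letters of a word, given the row and the value of the previous
letter. -/
def letterRows (r : ℤ) (a : ℕ) : List ℕ → List ℤ
  | [] => []
  | b :: w => if a < b then r :: letterRows r b w
      else min (r - 1) b :: letterRows (min (r - 1) b) b w

/-- The rows of the letters of a word in its weak descent tableau. -/
def rowList : List ℕ → List ℤ
  | [] => []
  | a :: w => (a : ℤ) :: letterRows a a w

/-- Each row of a list of rows, repeated according to its length. -/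
def repeatRows (L : List (ℤ × List ℕ)) : List ℤ :=
  L.flatMap fun p => List.replicate p.2.length p.1

theorem repeatRows_cons (p : ℤ × List ℕ) (L : List (ℤ × List ℕ)) :
    repeatRows (p :: L) = List.replicate p.2.length p.1 ++ repeatRows L := rfl

theorem exists_runFact_cons (a : ℕ) (w : List ℕ) :
    ∃ b bs, runFact (a :: w) = (a :: b) :: bs ∧ (∀ c ∈ bs, c ≠ []) ∧ ∀ r : ℤ,
      repeatRows ((r :: wdtRowsAux r bs).zip ((a :: b) :: bs)) = r :: letterRows r a w := by
  induction w generalizing a with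
  | nil => exact ⟨[], [], by simp [runFact], by simp, fun r => by
      simp [wdtRowsAux, repeatRows, letterRows]⟩
  | cons a' w ih =>
    obtain ⟨b, bs, h1, h2, h3⟩ := ih a'
    by_cases h : a < a'
    · refine ⟨a' :: b, bs, by rw [runFact, h1]; simp [h], h2, fun r => ?_⟩
      have := h3 r
      rw [List.zip_cons_cons, repeatRows_cons] at this ⊢
      rw [letterRows, if_pos h, ← this]
      simp [List.replicate_succ]
    · refine ⟨[], (a' :: b) :: bs, by rw [runFact, h1]; simp [h], by simpa using h2, fun r => ?_⟩
      have := h3 (min (r - 1) a')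
      rw [List.zip_cons_cons, repeatRows_cons, letterRows, if_neg h, ← this, wdtRowsAux]
      simp

theorem rowList_eq (w : List ℕ) :
    rowList w = repeatRows ((wdtRows (runFact w)).zip (runFact w)) := by
  cases w with
  | nil => rfl
  | cons a w =>
    obtain ⟨b, bs, h1, -, h3⟩ := exists_runFact_cons a w
    rw [h1, rowList, ← h3]
    rfl

theorem wdtRowsAux_length (r : ℤ) (bs : List (List ℕ)) :
    (wdtRowsAux r bs).length = bs.length := by
  induction bs generalizing r with
  | nil => rfl
  | cons b bs ih => simp [wdtRowsAux, ih]

theorem wdtRowsAux_pairwise (r : ℤ) (bs : List (List ℕ)) :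
    (r :: wdtRowsAux r bs).Pairwise (· > ·) := by
  induction bs generalizing r with
  | nil => simp [wdtRowsAux]
  | cons b bs ih =>
    have := ih (min (r - 1) b.headI)
    rw [wdtRowsAux, List.pairwise_cons]
    refine ⟨fun x hx => ?_, this⟩
    have h1 : min (r - 1) (b.headI : ℤ) < r := by omega
    rcases List.mem_cons.1 hx with rfl | hx
    · exact h1
    · exact lt_trans ((List.pairwise_cons.1 this).1 x hx) h1

theorem wdtRows_length (w : List ℕ) : (wdtRows (runFact w)).length = (runFact w).length := by
  cases runFact w with
  | nil => rfl
  | cons b bs => simp [wdtRows, wdtRowsAux_length]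

theorem wdtRows_nodup (w : List ℕ) : (wdtRows (runFact w)).Nodup := by
  cases runFact w with
  | nil => simp [wdtRows]
  | cons b bs => exact (wdtRowsAux_pairwise _ bs).imp fun h => ne_of_gt h

theorem count_repeatRows {L : List (ℤ × List ℕ)} (hL : (L.map Prod.fst).Nodup)
    {p : ℤ × List ℕ} (hp : p ∈ L) : (repeatRows L).count p.1 = p.2.length := by
  induction L with
  | nil => simp at hp
  | cons q L ih =>
    rw [List.map_cons, List.nodup_cons] at hL
    rw [repeatRows_cons, List.count_append]
    rcases List.mem_cons.1 hp with rfl | hp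
    · rw [List.count_replicate_self, List.count_eq_zero.2, add_zero]
      intro h
      obtain ⟨q, hq, hpq⟩ := List.mem_flatMap.1 h
      exact hL.1 (List.mem_map.2 ⟨q, hq, (List.eq_of_mem_replicate hpq).symm⟩)
    · rw [ih hL.2 hp, List.count_eq_zero.2, zero_add]
      intro h
      exact hL.1 (List.mem_map.2 ⟨p, hp, List.eq_of_mem_replicate h⟩)

theorem mem_runFact_mem {w b : List ℕ} (hb : b ∈ runFact w) : ∀ x ∈ b, x ∈ w := by
  induction w generalizing b with
  | nil => simp [runFact] at hb
  | cons a w ih =>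
    rw [runFact] at hb
    split at hb
    · simp_all
    · next r rs h =>
      split_ifs at hb
      · rcases List.mem_cons.1 hb with rfl | hb
        · intro x hx
          rcases List.mem_cons.1 hx with rfl | hx
          · simp
          · exact List.mem_cons_of_mem _ (ih (by simp [h]) x hx)
        · exact fun x hx => List.mem_cons_of_mem _ (ih (by simp [h, hb]) x hx)
      · rcases List.mem_cons.1 hb with rfl | hb
        · simp
        · exact fun x hx => List.mem_cons_of_mem _ (ih (by rw [h]; exact hb) x hx)

/-- The boxes in a row of the weak descent tableau of a word of positive letters. -/
theorem weakDesTab_row {w : List ℕ} (hw : PosWord w) (r : ℤ) :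
    {c | weakDesTab w r c ≠ 0} = Set.Icc 1 ((rowList w).count r) := by
  have hmap : (((wdtRows (runFact w)).zip (runFact w)).map Prod.fst).Nodup := by
    rw [List.map_fst_zip (wdtRows_length w).le]
    exact wdtRows_nodup w
  ext c
  rw [rowList_eq, Set.mem_ofPred_eq, Set.mem_Icc, weakDesTab]
  rcases Nat.eq_zero_or_pos c with rfl | hc
  · simp
  rw [if_neg hc.ne']
  split
  · next p hp =>
    have hpL := List.mem_of_find?_eq_some hp
    have hpr := List.find?_some hp
    simp only [decide_eq_true_eq] at hpr
    rw [← hpr, count_repeatRows hmap hpL]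
    constructor
    · intro h
      by_contra hlt
      exact h (List.getD_eq_default _ _ (by omega))
    · rintro ⟨-, h⟩
      rw [List.getD_eq_getElem _ _ (by omega)]
      have := hw _ (mem_runFact_mem (List.of_mem_zip hpL).2 _
        (List.getElem_mem (show c - 1 < p.2.length by omega)))
      omega
  · next hp =>
    rw [List.count_eq_zero.2]
    · simp only [ne_eq, not_true_eq_false, false_iff]
      omega
    · intro h
      obtain ⟨q, hq, hrq⟩ := List.mem_flatMap.1 h
      have := List.find?_eq_none.1 hp q hq
      simp only [decide_eq_true_eq] at this
      exact this (List.eq_of_mem_replicate hrq).symm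

theorem desComp_eq {w : List ℕ} (hw : PosWord w) (i : ℕ) :
    desComp w i = (rowList w).count (i : ℤ) := by
  rw [desComp, shapeOf, weakDesTab_row hw, ← Finset.coe_Icc, Set.ncard_coe_finset, Nat.card_Icc,
    Nat.add_sub_cancel]

theorem mem_rowList_iff (w : List ℕ) (r : ℤ) : r ∈ rowList w ↔ r ∈ wdtRows (runFact w) := by
  have hmap := List.map_fst_zip (wdtRows_length w).le
  have hne : ∀ b ∈ runFact w, b ≠ [] := by
    cases w with
    | nil => simp [runFact]
    | cons a w =>
      obtain ⟨b, bs, h1, h2, -⟩ := exists_runFact_cons a w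
      rw [h1]
      simpa using h2
  rw [rowList_eq, ← hmap, repeatRows, List.mem_flatMap, List.mem_map, hmap]
  refine exists_congr fun p => and_congr_right fun hp => ?_
  have : p.2.length ≠ 0 := fun h => hne _ (List.of_mem_zip hp).2 (List.length_eq_zero_iff.1 h)
  rw [List.mem_replicate]
  exact ⟨fun h => h.2.symm, fun h => ⟨this, h.symm⟩⟩

theorem nonVirtual_iff (w : List ℕ) : NonVirtual w ↔ ∀ r ∈ rowList w, 1 ≤ r := by
  simp only [mem_rowList_iff, NonVirtual]

theorem sum_count_eq_countP {L : List ℤ} (hL : ∀ r ∈ L, 1 ≤ r) (k : ℕ) :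
    ∑ j ∈ Finset.Icc 1 k, L.count (j : ℤ) = L.countP (· ≤ (k : ℤ)) := by
  induction L with
  | nil => simp
  | cons r L ih =>
    simp only [List.count_cons, List.countP_cons, Finset.sum_add_distrib]
    rw [ih fun x hx => hL x (by simp [hx])]
    obtain ⟨j, rfl⟩ := Int.eq_ofNat_of_zero_le (zero_le_one.trans (hL r (by simp)))
    have := hL _ (List.mem_cons_self ..)
    have h1 : 1 ≤ j := by omega
    congr 1
    simp [Finset.sum_ite_eq, h1]

theorem letterRows_le {r : ℤ} {a : ℕ} {w : List ℕ} : ∀ y ∈ letterRows r a w, y ≤ r := by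
  induction w generalizing r a with
  | nil => simp [letterRows]
  | cons b w ih =>
    intro y hy
    rw [letterRows] at hy
    split_ifs at hy
    · rcases List.mem_cons.1 hy with rfl | hy
      · rfl
      · exact ih y hy
    · rcases List.mem_cons.1 hy with rfl | hy
      · omega
      · have := ih y hy
        omega

theorem letterRows_forall₂ {r : ℤ} {a : ℕ} (w : List ℕ) (h : r ≤ a) :
    List.Forall₂ (fun (y : ℤ) (x : ℕ) => y ≤ x) (letterRows r a w) w := by
  induction w generalizing r a with
  | nil => exact .nil
  | cons b w ih =>
    rw [letterRows]
    split_ifs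
    · exact .cons (by omega) (ih (by omega))
    · exact .cons (by omega) (ih (by omega))

theorem rowList_forall₂ (w : List ℕ) :
    List.Forall₂ (fun (y : ℤ) (x : ℕ) => y ≤ x) (rowList w) w := by
  cases w with
  | nil => exact .nil
  | cons a w => exact .cons le_rfl (letterRows_forall₂ w le_rfl)

theorem rowList_length (w : List ℕ) : (rowList w).length = w.length :=
  (rowList_forall₂ w).length_eq

theorem rowList_pairwise (w : List ℕ) : (rowList w).Pairwise (· ≥ ·) := by
  have key : ∀ (w : List ℕ) (r : ℤ) (a : ℕ), (letterRows r a w).Pairwise (· ≥ ·) := by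
    intro w
    induction w with
    | nil => simp [letterRows]
    | cons b w ih =>
      intro r a
      rw [letterRows]
      split_ifs
      · exact List.pairwise_cons.2 ⟨letterRows_le, ih _ _⟩
      · exact List.pairwise_cons.2 ⟨letterRows_le, ih _ _⟩
  cases w with
  | nil => simp [rowList]
  | cons a w => exact List.pairwise_cons.2 ⟨letterRows_le, key _ _ _⟩

theorem exists_prefix_of_forall₂ {L : List ℤ} {w : List ℕ}
    (h : List.Forall₂ (fun (y : ℤ) (x : ℕ) => y ≤ x) L w) (hL : L.Pairwise (· ≥ ·)) (k : ℕ) :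
    ∃ u v, w = u ++ v ∧ u.length = L.countP ((k : ℤ) < ·) ∧ ∀ x ∈ u, k < x := by
  induction h with
  | nil => exact ⟨[], [], by simp⟩
  | @cons y x L w hyx h ih =>
    rw [List.pairwise_cons] at hL
    by_cases hy : (k : ℤ) < y
    · obtain ⟨u, v, rfl, h1, h2⟩ := ih hL.2
      refine ⟨x :: u, v, rfl, by simp [hy, h1], ?_⟩
      simp only [List.mem_cons, forall_eq_or_imp]
      exact ⟨by omega, h2⟩
    · refine ⟨[], x :: w, rfl, ?_, by simp⟩
      symm
      rw [List.length_nil, List.countP_eq_zero]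
      intro z hz
      rcases List.mem_cons.1 hz with rfl | hz
      · simpa using hy
      · have := hL.1 z hz
        simp only [decide_eq_true_eq]
        omega

theorem Flagged.forall₂_letterRows {m : ℕ} {G : List (List ℕ)} (hG : Flagged m G) {r : ℤ} {a : ℕ}
    (hr : (m + G.length : ℤ) ≤ r) :
    List.Forall₂ (fun (x : ℕ) (y : ℤ) => (x : ℤ) ≤ y) (blockRows m G)
      (letterRows r a G.flatten) := by
  induction G generalizing r a with
  | nil => exact .nil
  | cons F G ih =>
    obtain ⟨hF, hm, hG⟩ := hG
    have key : ∀ (F : List ℕ) (r : ℤ) (a : ℕ), (a :: F).Pairwise (· < ·) →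
        (m + G.length : ℤ) ≤ r → List.Forall₂ (fun (x : ℕ) (y : ℤ) => (x : ℤ) ≤ y)
          (List.replicate F.length (m + G.length) ++ blockRows m G)
          (letterRows r a (F ++ G.flatten)) := by
      intro F
      induction F with
      | nil => exact fun r a _ hr => ih hG hr
      | cons b F ihF =>
        intro r a hF hr
        rw [List.pairwise_cons] at hF
        rw [List.length_cons, List.replicate_succ, List.cons_append, List.cons_append, letterRows,
          if_pos (hF.1 b (by simp))]
        exact .cons (by omega) (ihF r b hF.2 hr)
    rw [List.length_cons] at hr
    rw [blockRows, List.flatten_cons]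
    cases F with
    | nil => exact ih hG (by omega)
    | cons b F =>
      have := hm b (by simp)
      rw [List.length_cons, List.replicate_succ, List.cons_append, List.cons_append, letterRows]
      split_ifs
      · exact .cons (by omega) (key F _ _ hF (by omega))
      · exact .cons (by omega) (key F _ _ hF (by omega))

theorem Flagged.forall₂_rowList {m : ℕ} {G : List (List ℕ)} (hG : Flagged m G) :
    List.Forall₂ (fun (x : ℕ) (y : ℤ) => (x : ℤ) ≤ y) (blockRows m G) (rowList G.flatten) := by
  have h := hG.forall₂_letterRows (a := G.flatten.headI)
    (le_max_right (G.flatten.headI + 1 : ℤ) (m + G.length))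
  have key : ∀ (w : List ℕ) (r : ℤ), (w.headI + 1 : ℤ) ≤ r →
      letterRows r w.headI w = rowList w := by
    rintro (_ | ⟨a, w⟩) r hr
    · rfl
    · have : min (r - 1) (a : ℤ) = a := by
        simp only [List.headI_cons] at hr
        omega
      rw [List.headI_cons, letterRows, if_neg (lt_irrefl a), this, rowList]
  rwa [key _ _ (le_max_left _ _)] at h

theorem countP_le_of_forall₂ {L : List ℕ} {M : List ℤ}
    (h : List.Forall₂ (fun (x : ℕ) (y : ℤ) => (x : ℤ) ≤ y) L M) (k : ℕ) :
    L.countP (k < ·) ≤ M.countP ((k : ℤ) < ·) := by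
  induction h with
  | nil => simp
  | @cons x y L M hxy h ih =>
    rw [List.countP_cons, List.countP_cons]
    refine add_le_add ih ?_
    by_cases hx : k < x
    · have : (k : ℤ) < y := by omega
      simp [hx, this]
    · simp [hx]

theorem countP_le_eq (L : List ℤ) (k : ℕ) :
    L.countP (· ≤ (k : ℤ)) + L.countP ((k : ℤ) < ·) = L.length := by
  rw [List.length_eq_countP_add_countP (p := fun y => decide (y ≤ (k : ℤ)))]
  simp

/-! ### The Yamanouchi word -/

theorem exists_yamanouchi {w : List ℕ} (hw : IsReducedWord w) {i : ℕ} (hi : 1 ≤ i)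
    (hmin : ∀ x ∈ w, i ≤ x) :
    ∃ σ, Yamanouchi σ ∧ CKEquiv w σ ∧ ∀ r ∈ rowList σ, (i : ℤ) ≤ r := by
  obtain ⟨T, hT, hck⟩ := exists_tab hw
  have hr := hw.of_ck hck
  obtain ⟨G, hG, hck', hcount⟩ := exists_flagged (w.toFinset.sup id + 1) i T hT hr
    (fun x hx => hmin x ((hck.mem_iff x).2 hx)) (fun x hx => by
      have : x ≤ w.toFinset.sup id :=
        Finset.le_sup (f := id) (List.mem_toFinset.2 ((hck.mem_iff x).2 hx))
      omega)
  have hred := hr.of_ck hck'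
  have hrows : ∀ r ∈ rowList G.flatten, (i : ℤ) ≤ r := by
    intro r h
    obtain ⟨n, hn, rfl⟩ := List.mem_iff_getElem.1 h
    have h2 := hG.forall₂_rowList
    have hn' : n < (blockRows i G).length := by rwa [h2.length_eq]
    have h3 := h2.get hn' hn
    have h4 := le_of_mem_blockRows (List.getElem_mem hn')
    simp only [List.get_eq_getElem] at h3
    omega
  have hrows1 : ∀ r ∈ rowList G.flatten, 1 ≤ r := fun r h => by
    have := hrows r h
    omega
  refine ⟨G.flatten, ⟨hred, (nonVirtual_iff _).2 hrows1, fun τ hτ hστ k => ?_⟩, hck.trans hck',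
    hrows⟩
  have hτred := hred.of_ck hστ
  simp only [desComp_eq hred.1, desComp_eq hτred.1]
  rw [sum_count_eq_countP hrows1, sum_count_eq_countP ((nonVirtual_iff _).1 hτ)]
  have h1 := countP_le_eq (rowList G.flatten) k
  have h2 := countP_le_eq (rowList τ) k
  rw [rowList_length] at h1 h2
  rw [← hστ.length_eq] at h2
  suffices h : (rowList τ).countP ((k : ℤ) < ·) ≤ (rowList G.flatten).countP ((k : ℤ) < ·) by
    omega
  by_cases hk : i ≤ k + 1
  · obtain ⟨u, v, rfl, hu, hku⟩ := exists_prefix_of_forall₂ (rowList_forall₂ τ)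
      (rowList_pairwise τ) k
    rw [← hu]
    refine (length_prefix_le_keyCount hT hr (hck'.trans hστ).symm le_rfl hku).trans ?_
    rw [← hcount _ k le_rfl hk]
    exact countP_le_of_forall₂ hG.forall₂_rowList k
  · have hall : (rowList G.flatten).countP ((k : ℤ) < ·) = (rowList G.flatten).length := by
      rw [List.countP_eq_length]
      intro r h
      have := hrows r h
      simp only [decide_eq_true_eq]
      omega
    rw [hall, rowList_length, hστ.length_eq, ← rowList_length]
    exact List.countP_le_length

noncomputable section
attribute [local instance] Classical.propDecidable

/-- Lemma `smallest row index`.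
If `ρ` is a reduced word whose smallest entry is `i`, then the first (lowest-index)
nonempty row of the weak Edelman–Greene insertion tableau `P̂(ρ)` has index `i`. -/
theorem hatP_first_row (ρ : List ℕ) (hρ : IsReducedWord ρ) (i : ℕ)
    (hmem : i ∈ ρ) (hmin : ∀ x ∈ ρ, i ≤ x) :
    (∃ c : ℕ, hatP ρ (i : ℤ) c ≠ 0) ∧
      ∀ r : ℤ, r < (i : ℤ) → ∀ c : ℕ, hatP ρ r c = 0 := by
  have hi := hρ.1 i hmem
  obtain ⟨σ, hσ, hρσ, hrows⟩ := exists_yamanouchi hρ hi hmin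
  have hex : ∃ σ, Yamanouchi σ ∧ CKEquiv ρ σ := ⟨σ, hσ, hρσ⟩
  obtain ⟨τ, hτ, hρτ, hP⟩ : ∃ τ, Yamanouchi τ ∧ CKEquiv ρ τ ∧ hatP ρ = weakDesTab τ :=
    ⟨hex.choose, hex.choose_spec.1, hex.choose_spec.2, by rw [hatP, hatRho, dif_pos hex]⟩
  rw [hP]
  have hrow := weakDesTab_row hτ.1.1
  have hle := hτ.2.2 σ hσ.2.1 (hρτ.symm.trans hρσ) (i - 1)
  simp only [desComp_eq hτ.1.1, desComp_eq hσ.1.1] at hle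
  have hzero : (rowList σ).countP (· ≤ ((i - 1 : ℕ) : ℤ)) = 0 := by
    rw [List.countP_eq_zero]
    intro r h
    have := hrows r h
    simp only [decide_eq_true_eq]
    omega
  rw [sum_count_eq_countP ((nonVirtual_iff _).1 hτ.2.1),
    sum_count_eq_countP ((nonVirtual_iff _).1 hσ.2.1), hzero, Nat.le_zero,
    List.countP_eq_zero] at hle
  have hτrows : ∀ r ∈ rowList τ, (i : ℤ) ≤ r := fun r h => by
    have := hle r h
    simp only [decide_eq_true_eq] at this
    omega
  constructor
  · have h2 := rowList_forall₂ τ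
    obtain ⟨n, hn, hni⟩ := List.mem_iff_getElem.1 ((hρτ.mem_iff i).1 hmem)
    have hn' : n < (rowList τ).length := by rwa [h2.length_eq]
    have h3 := h2.get hn' hn
    have h4 := List.getElem_mem hn'
    have h5 := hτrows _ h4
    simp only [List.get_eq_getElem, hni] at h3
    rw [le_antisymm h3 h5] at h4
    have : (1 : ℕ) ∈ {c | weakDesTab τ (i : ℤ) c ≠ 0} := by
      rw [hrow]
      exact ⟨le_rfl, List.count_pos_iff.2 h4⟩
    exact ⟨1, this⟩
  · intro r hr c
    by_contra hc
    have : c ∈ {c | weakDesTab τ r c ≠ 0} := hc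
    rw [hrow, List.count_eq_zero.2 fun h => absurd (hτrows r h) (not_le.2 hr)] at this
    have h1 := this.1
    have h2 := this.2
    omega

end
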